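/- arXiv:2601.04001 — 11 statements merged into one kernel-verified Lean document; each statement's English description precedes it below -/
import Mathlib

section
/- Let d ≥ 3 and let G be a finite simple graph in which every vertex has degree at most d and which contains no clique on d+1 vertices (no set of d+1 pairwise adjacent vertices). Then G admits a proper d-coloring (Brooks' theorem for finite graphs). -/
namespace Brooks

open Finset

variable {V : Type*} {G : SimpleGraph V} {d : ℕ}

/-- `c` is a proper coloring of the subgraph of `G` induced on `S`. -/
def ProperOn (G : SimpleGraph V) (S : Finset V) (c : V → Fin d) : Prop :=
  ∀ x ∈ S, ∀ y ∈ S, G.Adj x y → c x ≠ c y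

open Classical in
/-- A color `k` missing from the colored neighbors of `v` can be given to `v`. -/
lemma ProperOn.update {A : Finset V} {c : V → Fin d} (hc : ProperOn G A c) {v : V} {k : Fin d}
    (hk : ∀ y ∈ A, G.Adj v y → c y ≠ k) : ProperOn G (insert v A) (Function.update c v k) := by
  intro x hx y hy hxy
  have hne := hxy.ne
  rw [mem_insert] at hx hy
  by_cases hxv : x = v
  · subst hxv
    have hyA := hy.resolve_left hne.symm
    simpa [Function.update_of_ne hne.symm] using (hk y hyA hxy).symm
  · have hxA := hx.resolve_left hxv
    by_cases hyv : y = v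
    · subst hyv
      simpa [Function.update_of_ne hne] using hk x hxA hxy.symm
    · simpa [Function.update_of_ne hxv, Function.update_of_ne hyv] using
        hc x hxA y (hy.resolve_left hyv) hxy

open Classical in
/-- Greedy step: if the colored neighbors of `v` lie in a set with fewer than `d` colors, then the
coloring extends to `v`. -/
lemma ProperOn.exists_insert {A : Finset V} {c : V → Fin d} (hc : ProperOn G A c) {v : V}
    (hv : v ∉ A) {T : Finset V} (hT : ∀ y ∈ A, G.Adj v y → y ∈ T) (hcard : #(T.image c) < d) :
    ∃ c' : V → Fin d, ProperOn G (insert v A) c' ∧ ∀ x ∈ A, c' x = c x := by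
  obtain ⟨k, hk⟩ : ∃ k, k ∉ T.image c := by
    by_contra! h
    have : T.image c = univ := eq_univ_of_forall h
    simp [this] at hcard
  refine ⟨Function.update c v k, hc.update fun y hy hvy hck => ?_, fun x hx => ?_⟩
  · exact hk (mem_image.2 ⟨y, hT y hy hvy, hck⟩)
  · exact Function.update_of_ne (ne_of_mem_of_not_mem hx hv) _ _

/-- A list containing an element satisfying `P` splits at the first such element. -/
lemma exists_append_cons_of_mem {α : Type*} {P : α → Prop} {l : List α} (h : ∃ a ∈ l, P a) :
    ∃ l₁ a l₂, l = l₁ ++ a :: l₂ ∧ P a ∧ ∀ b ∈ l₁, ¬ P b := by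
  induction l with
  | nil => simp at h
  | cons b l ih =>
    by_cases hb : P b
    · exact ⟨[], b, l, rfl, hb, by simp⟩
    · obtain ⟨l₁, a, l₂, rfl, ha, hl⟩ := ih (by simpa [hb] using h)
      exact ⟨b :: l₁, a, l₂, rfl, ha, by simpa [hb] using hl⟩

/-- If the first vertex of a path has all its neighbors on the path, and at least one, then the
path starts with a cycle (possibly a single edge) containing all of these neighbors. -/
lemma exists_initial_cycle {p : List V} {h a : V} (hh : h ∈ p.head?)
    (hclosed : ∀ w, G.Adj h w → w ∈ p) (hha : G.Adj h a) :
    ∃ C, C <+: p ∧ h ∈ C.head? ∧ (∀ b ∈ C.getLast?, G.Adj h b) ∧ ∀ w, G.Adj h w → w ∈ C := by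
  obtain ⟨l₁, b, l₂, hl, hb, hl₁⟩ := exists_append_cons_of_mem (P := G.Adj h) (l := p.reverse)
    ⟨a, by simpa using hclosed a hha, hha⟩
  have hp : p = (b :: l₂).reverse ++ l₁.reverse := by
    rw [← List.reverse_append, ← hl, List.reverse_reverse]
  refine ⟨(b :: l₂).reverse, ⟨l₁.reverse, hp.symm⟩, ?_, ?_, fun w hw => ?_⟩
  · rw [hp, List.head?_append_of_ne_nil _ (by simp)] at hh
    exact hh
  · simpa using hb
  · have hwp := hclosed w hw
    rw [hp, List.mem_append] at hwp
    exact hwp.resolve_right fun hwl => hl₁ w (by simpa using hwl) hw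

variable [Fintype V]

open Classical in
/-- A vertex with an uncolored neighbor can be colored. -/
lemma ProperOn.exists_insert_of_adj_notMem (hdeg : ∀ v, G.degree v ≤ d) {A : Finset V}
    {c : V → Fin d} (hc : ProperOn G A c) {v w : V} (hv : v ∉ A) (hvw : G.Adj v w) (hw : w ∉ A) :
    ∃ c' : V → Fin d, ProperOn G (insert v A) c' ∧ ∀ x ∈ A, c' x = c x := by
  refine hc.exists_insert hv (T := (G.neighborFinset v).erase w) (fun y hy hvy => ?_) ?_
  · simp only [mem_erase, SimpleGraph.mem_neighborFinset]
    exact ⟨fun h => hw (h ▸ hy), hvy⟩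
  · exact card_image_le.trans_lt
      ((card_erase_lt_of_mem (by simpa using hvw)).trans_le (hdeg v))

open Classical in
/-- A vertex with two neighbors of the same color can be colored. -/
lemma ProperOn.exists_insert_of_color_eq (hdeg : ∀ v, G.degree v ≤ d) {A : Finset V}
    {c : V → Fin d} (hc : ProperOn G A c) {v x y : V} (hv : v ∉ A) (hvx : G.Adj v x)
    (hvy : G.Adj v y) (hxy : x ≠ y) (hcxy : c x = c y) :
    ∃ c' : V → Fin d, ProperOn G (insert v A) c' ∧ ∀ x ∈ A, c' x = c x := by
  refine hc.exists_insert hv (T := G.neighborFinset v) (fun y hy hvy => by simpa using hvy) ?_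
  have hsub : (G.neighborFinset v).image c ⊆ ((G.neighborFinset v).erase x).image c := by
    intro k hk
    obtain ⟨z, hz, rfl⟩ := mem_image.1 hk
    by_cases hzx : z = x
    · subst hzx
      exact mem_image.2 ⟨y, mem_erase.2 ⟨hxy.symm, by simpa using hvy⟩, hcxy.symm⟩
    · exact mem_image.2 ⟨z, mem_erase.2 ⟨hzx, hz⟩, rfl⟩
  exact (card_le_card hsub).trans_lt (card_image_le.trans_lt
    ((card_erase_lt_of_mem (by simpa using hvx)).trans_le (hdeg v)))

open Classical in
/-- The vertices of a path of uncolored vertices, except for its end `z`, can be colored in the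
order in which they appear. -/
lemma ProperOn.exists_union_path (hdeg : ∀ v, G.degree v ≤ d) {z : V} (l : List V) :
    ∀ {A : Finset V} {c : V → Fin d}, ProperOn G A c → (l ++ [z]).IsChain G.Adj →
      (l ++ [z]).Nodup → (∀ x ∈ l ++ [z], x ∉ A) →
      ∃ c' : V → Fin d, ProperOn G (A ∪ l.toFinset) c' ∧ ∀ x ∈ A, c' x = c x := by
  induction l with
  | nil => exact fun {A c} hc _ _ _ => ⟨c, by simpa using hc, fun _ _ => rfl⟩
  | cons a l ih =>
    intro A c hc hchain hnodup hA
    rw [List.cons_append, List.isChain_cons] at hchain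
    rw [List.cons_append, List.nodup_cons] at hnodup
    obtain ⟨w, hw⟩ : ∃ w, w ∈ (l ++ [z]).head? := by cases l <;> simp
    obtain ⟨c₁, hc₁, hcc₁⟩ := hc.exists_insert_of_adj_notMem hdeg (hA a (by simp))
      (hchain.1 w hw) (hA w (List.mem_cons_of_mem _ (List.mem_of_mem_head? hw)))
    obtain ⟨c₂, hc₂, hcc₂⟩ := ih hc₁ hchain.2 hnodup.2 fun x hx hxA => by
      rcases mem_insert.1 hxA with rfl | hxA
      · exact hnodup.1 hx
      · exact hA x (List.mem_cons_of_mem _ hx) hxA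
    refine ⟨c₂, ?_, fun x hx => (hcc₂ x (mem_insert_of_mem hx)).trans (hcc₁ x hx)⟩
    have : A ∪ (a :: l).toFinset = insert a A ∪ l.toFinset := by ext; simp
    rwa [this]

open Classical in
/-- If a set `S` has a Hamiltonian path ending in `y, v, x` with `x` and `y` non-adjacent, and `v`
has a third neighbor in `S`, then `S` is `d`-colorable. -/
lemma exists_properOn_of_path (hd : 0 < d) (hdeg : ∀ v, G.degree v ≤ d) {q : List V} {x v y z : V}
    (hchain : (q ++ [y, v, x]).IsChain G.Adj) (hnodup : (q ++ [y, v, x]).Nodup)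
    (hxy : ¬ G.Adj x y) (hz : z ∈ q) (hvz : G.Adj v z) :
    ∃ c : V → Fin d, ProperOn G (q ++ [y, v, x]).toFinset c := by
  obtain ⟨q₁, q₂, rfl⟩ := List.append_of_mem hz
  simp only [List.nodup_append, List.nodup_cons, List.mem_append, List.mem_cons] at hnodup
  have hyx : ¬ G.Adj y x := fun h => hxy h.symm
  have hc₀ : ProperOn G {x, y} (fun _ => (⟨0, hd⟩ : Fin d)) := by
    intro a ha b hb hab
    simp only [mem_insert, mem_singleton] at ha hb
    rcases ha with rfl | rfl <;> rcases hb with rfl | rfl <;> simp_all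
  have hvy : G.Adj v y ∧ G.Adj v x := by
    have := (List.isChain_append.1 hchain).2.1
    simp at this
    exact ⟨this.1.symm, this.2⟩
  have hch := (List.isChain_append.1 hchain).1
  obtain ⟨c₁, hc₁, hcc₁⟩ := hc₀.exists_union_path hdeg (z := z) q₂.reverse
    (by
      rw [← List.reverse_cons, List.isChain_reverse]
      exact (List.isChain_append.1 hch).2.1.imp fun _ _ h => h.symm)
    (by
      rw [← List.reverse_cons, List.nodup_reverse, List.nodup_cons]
      grind)
    (by
      simp only [mem_insert, mem_singleton, List.mem_reverse, List.mem_append, List.mem_cons]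
      grind)
  obtain ⟨c₂, hc₂, hcc₂⟩ := hc₁.exists_union_path hdeg (z := v) (q₁ ++ [z])
    (by
      rw [List.isChain_append]
      refine ⟨?_, by simp, by simpa using hvz.symm⟩
      rw [List.append_cons] at hch
      exact (List.isChain_append.1 hch).1)
    (by
      simp only [List.nodup_append, List.nodup_cons, List.mem_append, List.mem_cons]
      grind)
    (by
      simp only [mem_union, mem_insert, mem_singleton, List.mem_toFinset, List.mem_reverse,
        List.mem_append, List.mem_cons]
      grind)
  obtain ⟨c₃, hc₃, -⟩ := hc₂.exists_insert_of_color_eq hdeg (v := v) (x := x) (y := y)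
    (by
      simp only [mem_union, mem_insert, mem_singleton, List.mem_toFinset, List.mem_reverse,
        List.mem_append, List.mem_cons]
      grind) hvy.2 hvy.1 (by grind)
    (by rw [hcc₂ x (by simp), hcc₂ y (by simp), hcc₁ x (by simp), hcc₁ y (by simp)])
  refine ⟨c₃, ?_⟩
  convert hc₃ using 1
  ext
  simp
  tauto

open Classical in
/-- A coloring of `B` extends to a cycle disjoint from `B`, if its first vertex has no neighbor
in `B` but some vertex of it does. -/
lemma ProperOn.exists_union_cycle (hdeg : ∀ v, G.degree v ≤ d) {B : Finset V}
    {c : V → Fin d} (hc : ProperOn G B c) {C : List V} (hchain : C.IsChain G.Adj)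
    (hnodup : C.Nodup) (hB : ∀ x ∈ C, x ∉ B)
    (hcycle : ∀ h ∈ C.head?, ∀ a ∈ C.getLast?, G.Adj h a)
    (hhead : ∀ h ∈ C.head?, ∀ w ∈ B, ¬ G.Adj h w) (hex : ∃ u ∈ C, ∃ w ∈ B, G.Adj u w) :
    ∃ c' : V → Fin d, ProperOn G (B ∪ C.toFinset) c' := by
  obtain ⟨l₁, u, l₂, rfl, ⟨w, hw, huw⟩, hl₁⟩ := exists_append_cons_of_mem hex
  rcases List.eq_nil_or_concat l₁ with rfl | ⟨l, u', rfl⟩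
  · exact absurd huw (hhead u (by simp) w hw)
  have hl₁' : ∀ w ∈ B, ¬ G.Adj u' w := fun w hw h => hl₁ u' (by simp) ⟨w, hw, h⟩
  have hc₁ := hc.update (v := u') (k := c w) fun y hy h => absurd h (hl₁' y hy)
  have hu'B : u' ∉ B := hB u' (by simp)
  have hwu' : w ≠ u' := fun h => hu'B (h ▸ hw)
  have huu' : G.Adj u' u := by
    have := (List.isChain_append.1 hchain).2.2
    simpa using this
  simp only [List.concat_eq_append, List.nodup_append, List.nodup_cons, List.mem_append,
    List.mem_cons] at hnodup hB
  have hrot : (u' :: (l.reverse ++ l₂.reverse ++ [u])).IsChain G.Adj := by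
    have hsplit : u' :: (l.reverse ++ l₂.reverse ++ [u])
        = (l ++ [u']).reverse ++ (u :: l₂).reverse := by simp
    rw [hsplit, List.isChain_append, List.isChain_reverse, List.isChain_reverse]
    simp only [List.concat_eq_append] at hchain hcycle
    refine ⟨(List.isChain_append.1 hchain).1.imp fun _ _ h => h.symm,
      (List.isChain_append.1 hchain).2.1.imp fun _ _ h => h.symm, fun a ha b hb => ?_⟩
    refine hcycle a ?_ b ?_
    · rw [List.getLast?_reverse] at ha
      rw [List.head?_append, ha]
      simp
    · rw [List.head?_reverse] at hb
      rw [List.getLast?_append, hb]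
      simp
  obtain ⟨c₂, hc₂, hcc₂⟩ := hc₁.exists_union_path hdeg (z := u) (l.reverse ++ l₂.reverse)
    (List.isChain_cons.1 hrot).2
    (by
      simp only [List.nodup_append, List.nodup_reverse, List.nodup_cons, List.mem_append,
        List.mem_reverse, List.mem_cons]
      clear hcycle hhead hex hl₁ hrot hchain hc₁
      grind)
    (by
      simp only [mem_insert, List.mem_append, List.mem_reverse, List.mem_cons]
      clear hcycle hhead hex hl₁ hrot hchain hc₁
      grind)
  obtain ⟨c₃, hc₃, -⟩ := hc₂.exists_insert_of_color_eq hdeg (v := u) (x := u') (y := w)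
    (by
      simp only [mem_union, mem_insert, List.mem_toFinset, List.mem_append, List.mem_reverse]
      grind) huu'.symm huw hwu'.symm
    (by
      rw [hcc₂ u' (by simp), hcc₂ w (by simp [hw])]
      simp [Function.update_of_ne hwu'])
  refine ⟨c₃, ?_⟩
  convert hc₃ using 1
  ext
  simp
  tauto

/-- A path can be prolonged at its head until all neighbors of the head lie on it. -/
lemma exists_maximal_path {p : List V} (hp : p.IsChain G.Adj) (hnodup : p.Nodup) :
    ∃ q : List V, (q ++ p).IsChain G.Adj ∧ (q ++ p).Nodup ∧
      ∀ h ∈ (q ++ p).head?, ∀ w, G.Adj h w → w ∈ q ++ p := by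
  induction hn : Fintype.card V - p.length using Nat.strong_induction_on generalizing p with
  | _ n ih =>
    by_cases hmax : ∀ h ∈ p.head?, ∀ w, G.Adj h w → w ∈ p
    · exact ⟨[], hp, hnodup, hmax⟩
    push Not at hmax
    obtain ⟨h, hh, w, hhw, hw⟩ := hmax
    have hnodup' : (w :: p).Nodup := List.nodup_cons.2 ⟨hw, hnodup⟩
    have hlen := hnodup'.length_le_card
    rw [List.length_cons] at hlen
    obtain ⟨q, hq⟩ := ih _ (by rw [List.length_cons]; omega) (p := w :: p)
      (List.isChain_cons.2 ⟨fun y hy => by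
        rw [Option.mem_unique hy hh]
        exact hhw.symm, hp⟩) hnodup' rfl
    exact ⟨q ++ [w], by simpa using hq⟩

open Classical in
/-- Some two neighbors of a vertex of degree `d` are non-adjacent if there is no clique of size
`d + 1`. -/
lemma exists_not_adj_of_cliqueFree (hclique : G.CliqueFree (d + 1)) {v : V}
    (hv : G.degree v = d) : ∃ x y, G.Adj v x ∧ G.Adj v y ∧ x ≠ y ∧ ¬ G.Adj x y := by
  by_contra! h
  refine hclique (insert v (G.neighborFinset v)) ⟨?_, ?_⟩
  · rw [coe_insert, SimpleGraph.isClique_insert]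
    refine ⟨fun x hx y hy hxy => h x y (by simpa using hx) (by simpa using hy) hxy, ?_⟩
    exact fun x hx _ => by simpa using hx
  · rw [card_insert_of_notMem (by simp), SimpleGraph.card_neighborFinset_eq_degree, hv]

open Classical in
/-- Brooks' theorem for induced subgraphs. -/
lemma exists_properOn (hd : 3 ≤ d) (hdeg : ∀ v, G.degree v ≤ d)
    (hclique : G.CliqueFree (d + 1)) (S : Finset V) : ∃ c : V → Fin d, ProperOn G S c := by
  induction S using Finset.strongInduction with
  | _ S ih =>
    rcases S.eq_empty_or_nonempty with rfl | ⟨v, hvS⟩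
    · exact ⟨fun _ => ⟨0, by omega⟩, fun x hx => by simp at hx⟩
    by_cases hreg : ∃ u ∈ S, #(G.neighborFinset u ∩ S) < d
    · obtain ⟨u, hu, hlt⟩ := hreg
      obtain ⟨c, hc⟩ := ih _ (erase_ssubset hu)
      obtain ⟨c', hc', -⟩ := hc.exists_insert (notMem_erase u S)
        (T := G.neighborFinset u ∩ S) (fun y hy huy => by simp_all)
        (card_image_le.trans_lt hlt)
      exact ⟨c', by rwa [insert_erase hu] at hc'⟩
    push Not at hreg
    have hclosed : ∀ u ∈ S, ∀ w, G.Adj u w → w ∈ S := fun u hu w huw => by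
      have := eq_of_subset_of_card_le (inter_subset_left (s₁ := G.neighborFinset u) (s₂ := S))
        ((hdeg u).trans (hreg u hu))
      exact inter_eq_left.1 this (by simpa using huw)
    have hdegv : G.degree v = d :=
      (hdeg v).antisymm ((hreg v hvS).trans (card_le_card inter_subset_left))
    obtain ⟨x, y, hvx, hvy, hxy, hnadj⟩ := exists_not_adj_of_cliqueFree hclique hdegv
    obtain ⟨q, hchain, hnodup, hmax⟩ := exists_maximal_path (G := G) (p := [y, v, x])
      (by simp [hvx, hvy.symm]) (by simp [hvx.ne, hvy.ne', hxy.symm])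
    have hpS : ∀ u ∈ q ++ [y, v, x], u ∈ S := by
      have hxS := hclosed v hvS x hvx
      have hyS := hclosed v hvS y hvy
      clear hmax hnodup
      induction q with
      | nil => simp [*]
      | cons a q ihq =>
        rw [List.cons_append, List.isChain_cons] at hchain
        have hq := ihq hchain.2
        obtain ⟨b, hb⟩ : ∃ b, b ∈ (q ++ [y, v, x]).head? := by cases q <;> simp
        intro u hu
        rw [List.cons_append, List.mem_cons] at hu
        rcases hu with rfl | hu
        · exact hclosed b (hq b (List.mem_of_mem_head? hb)) _ (hchain.1 b hb).symm
        · exact hq u hu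
    by_cases hham : S ⊆ (q ++ [y, v, x]).toFinset
    · obtain ⟨z, hz, hzxy⟩ : ∃ z ∈ G.neighborFinset v, z ∉ ({x, y} : Finset V) := by
        refine exists_mem_notMem_of_card_lt_card (card_le_two.trans_lt ?_)
        rw [SimpleGraph.card_neighborFinset_eq_degree]
        omega
      rw [SimpleGraph.mem_neighborFinset] at hz
      have hzq : z ∈ q := by
        have := hham (hclosed v hvS z hz)
        have := hz.ne'
        simp_all
      obtain ⟨c, hc⟩ := exists_properOn_of_path (by omega) hdeg hchain hnodup hnadj hzq hz
      exact ⟨c, fun a ha b hb => hc a (hham ha) b (hham hb)⟩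
    obtain ⟨h, hh⟩ : ∃ h, h ∈ (q ++ [y, v, x]).head? := by cases q <;> simp
    have hhS := hpS h (List.mem_of_mem_head? hh)
    obtain ⟨a, ha⟩ : (G.neighborFinset h ∩ S).Nonempty :=
      card_pos.1 (by have := hreg h hhS; omega)
    obtain ⟨C, hC, hhC, hlast, hnbr⟩ := exists_initial_cycle hh (hmax h hh)
      (a := a) (by simp_all)
    have hCS : C.toFinset ⊆ S := fun u hu => hpS u (hC.subset (by simpa using hu))
    have hCne : C.toFinset ≠ S := fun he =>
      hham fun u hu => by
        rw [← he, List.mem_toFinset] at hu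
        exact List.mem_toFinset.2 (hC.subset hu)
    obtain ⟨c, hc⟩ := ih (S \ C.toFinset)
      (sdiff_ssubset hCS ⟨h, by simpa using List.mem_of_mem_head? hhC⟩)
    by_cases hex : ∃ u ∈ C, ∃ w ∈ S \ C.toFinset, G.Adj u w
    · obtain ⟨c', hc'⟩ := hc.exists_union_cycle hdeg (C := C)
        (List.isChain_append.1 (hC.choose_spec.symm ▸ hchain)).1
        (hnodup.sublist hC.sublist) (by simp_all)
        (fun h' hh' => by rwa [Option.mem_unique hh' hhC])
        (fun h' hh' w hw hadj => by
          rw [Option.mem_unique hh' hhC] at hadj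
          have := hnbr w hadj
          simp_all) hex
      exact ⟨c', by rwa [sdiff_union_of_subset hCS] at hc'⟩
    push Not at hex
    obtain ⟨c', hc'⟩ := ih _ (hCS.ssubset_of_ne hCne)
    refine ⟨fun u => if u ∈ C then c' u else c u, fun a ha b hb hab => ?_⟩
    by_cases haC : a ∈ C <;> by_cases hbC : b ∈ C
    · simpa [haC, hbC] using hc' a (by simpa) b (by simpa) hab
    · exact absurd hab (hex a haC b (by simp_all))
    · exact absurd hab.symm (hex b hbC a (by simp_all))
    · simpa [haC, hbC] using hc a (by simp_all) b (by simp_all) hab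

end Brooks

theorem stmt1 {V : Type} [Fintype V] (G : SimpleGraph V) (d : ℕ) (hd : 3 ≤ d)
    (hdeg : ∀ v : V, (G.neighborSet v).ncard ≤ d)
    (hclique : G.CliqueFree (d + 1)) :
    ∃ c : V → Fin d, ∀ x y : V, G.Adj x y → c x ≠ c y := by
  classical
  obtain ⟨c, hc⟩ := Brooks.exists_properOn hd (G := G) (fun v => by
    have := hdeg v
    rwa [Set.ncard_eq_toFinset_card', ← SimpleGraph.neighborFinset_def,
      SimpleGraph.card_neighborFinset_eq_degree] at this) hclique Finset.univ
  exact ⟨c, fun x y => hc x (Finset.mem_univ x) y (Finset.mem_univ y)⟩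
end

section
/- Let d ≥ 3 and let G be a countable simple graph in which every vertex has degree at most d and which contains no clique on d+1 vertices. Then G admits a proper d-coloring (Brooks' theorem for countably infinite graphs). -/
/-- The map `c` restricts to a proper coloring of the subgraph of `G` induced by `T`. -/
def ProperOn {V α : Type*} (G : SimpleGraph V) (T : Finset V) (c : V → α) : Prop :=
  ∀ x ∈ T, ∀ y ∈ T, G.Adj x y → c x ≠ c y

namespace ProperOn

variable {V : Type*} {G : SimpleGraph V} {d : ℕ}

lemma insert_update {α : Type*} [DecidableEq V] {T : Finset V} {c : V → α} (hc : ProperOn G T c)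
    {v : V} (hv : v ∉ T) {k : α} (hk : ∀ w ∈ T, G.Adj v w → c w ≠ k) :
    ProperOn G (insert v T) (Function.update c v k) := by
  intro x hx y hy hxy
  rw [Finset.mem_insert] at hx hy
  have hne := hxy.ne
  rcases hx with rfl | hx <;> rcases hy with rfl | hy
  · exact absurd rfl hne
  · rw [Function.update_self, Function.update_of_ne hne.symm]
    exact (hk y hy hxy).symm
  · rw [Function.update_self, Function.update_of_ne hne]
    exact hk x hx hxy.symm
  · rw [Function.update_of_ne (by grind), Function.update_of_ne (by grind)]
    exact hc x hx y hy hxy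

lemma exists_insert [DecidableEq V] [DecidableRel G.Adj] {T : Finset V} {c : V → Fin d}
    (hc : ProperOn G T c) {v : V} (hv : v ∉ T)
    (h : ((T.filter (G.Adj v)).image c).card < d) :
    ∃ c' : V → Fin d, ProperOn G (insert v T) c' ∧ ∀ w ∈ T, c' w = c w := by
  obtain ⟨k, hk⟩ : ∃ k, k ∉ (T.filter (G.Adj v)).image c := by
    by_contra! hall
    rw [Finset.eq_univ_iff_forall.2 hall] at h
    simp at h
  refine ⟨_, hc.insert_update hv (k := k) ?_, fun w hw ↦ Function.update_of_ne (by grind) _ _⟩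
  intro w hw hvw hwk
  exact hk (Finset.mem_image.2 ⟨w, by simp [hw, hvw], hwk⟩)

lemma union {α : Type*} [DecidableEq V] {S T : Finset V} {c e : V → α}
    (hc : ProperOn G S c) (he : ProperOn G T e) (h : ∀ x ∈ S, ∀ y ∈ T, ¬ G.Adj x y) :
    ∃ c' : V → α, ProperOn G (S ∪ T) c' := by
  refine ⟨fun x ↦ if x ∈ S then c x else e x, fun x hx y hy hxy ↦ ?_⟩
  have := hxy.symm
  by_cases hxS : x ∈ S <;> by_cases hyS : y ∈ S <;> simp only [hxS, hyS, if_true, if_false] <;>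
    grind [ProperOn]

end ProperOn

section Degree

variable {V : Type*} {G : SimpleGraph V} {d : ℕ}

lemma card_filter_adj_le [DecidableRel G.Adj]
    (hdeg : ∀ v, (G.neighborSet v).Finite ∧ (G.neighborSet v).ncard ≤ d) (T : Finset V) (v : V) :
    (T.filter (G.Adj v)).card ≤ d := by
  rw [← Set.ncard_coe_finset]
  exact (Set.ncard_le_ncard (by intro w; simp) (hdeg v).1).trans (hdeg v).2

lemma card_filter_adj_lt [DecidableRel G.Adj] [DecidableEq V]
    (hdeg : ∀ v, (G.neighborSet v).Finite ∧ (G.neighborSet v).ncard ≤ d) {T : Finset V} {v w : V}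
    (hvw : G.Adj v w) (hw : w ∉ T) : (T.filter (G.Adj v)).card < d := by
  have h := card_filter_adj_le hdeg (insert w T) v
  rw [Finset.filter_insert, if_pos hvw, Finset.card_insert_of_notMem (by simp [hw])] at h
  exact h

/-- A proper coloring extends greedily along a path of uncolored vertices, except for the last
one. -/
lemma ProperOn.extend_path [DecidableEq V]
    (hdeg : ∀ v, (G.neighborSet v).Finite ∧ (G.neighborSet v).ncard ≤ d) {u : V} (l : List V) :
    ∀ {T : Finset V} {c : V → Fin d}, ProperOn G T c → (l ++ [u]).IsChain G.Adj →
      (l ++ [u]).Nodup → (∀ x ∈ l ++ [u], x ∉ T) →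
      ∃ c' : V → Fin d, ProperOn G (T ∪ l.toFinset) c' ∧ ∀ w ∈ T, c' w = c w := by
  classical
  induction l with
  | nil => exact fun {T c} hc _ _ _ ↦ ⟨c, by simpa using hc, fun _ _ ↦ rfl⟩
  | cons x l ih =>
    intro T c hc hl hnd hT
    obtain ⟨y, hy, hxy⟩ : ∃ y ∈ l ++ [u], G.Adj x y := by
      cases l with
      | nil => exact ⟨u, by simp, by simpa using hl⟩
      | cons y l => exact ⟨y, by simp, by simp at hl; exact hl.1⟩
    have hlt := card_filter_adj_lt hdeg hxy (hT y (by simp at hy ⊢; tauto))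
    obtain ⟨c₁, hc₁, h₁⟩ := hc.exists_insert (hT x (by simp))
      (Finset.card_image_le.trans_lt hlt)
    rw [List.cons_append] at hl hnd hT
    obtain ⟨c₂, hc₂, h₂⟩ := ih hc₁ hl.tail hnd.of_cons (by
      intro z hz
      have := List.nodup_cons.1 hnd
      have := hT z (List.mem_cons_of_mem _ hz)
      grind)
    refine ⟨c₂, ?_, fun w hw ↦ (h₂ w (by simp [hw])).trans (h₁ w hw)⟩
    convert hc₂ using 1
    ext; simp

/-- A proper coloring extends along a path of uncolored vertices whose last vertex has two
neighbors of the same color. -/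
lemma ProperOn.extend_path_of_eq [DecidableEq V]
    (hdeg : ∀ v, (G.neighborSet v).Finite ∧ (G.neighborSet v).ncard ≤ d) {u p q : V} {l : List V}
    {T : Finset V} {c : V → Fin d} (hc : ProperOn G T c) (hl : (l ++ [u]).IsChain G.Adj)
    (hnd : (l ++ [u]).Nodup) (hT : ∀ x ∈ l ++ [u], x ∉ T) (hp : p ∈ T) (hq : q ∈ T) (hpq : p ≠ q)
    (hup : G.Adj u p) (huq : G.Adj u q) (hcpq : c p = c q) :
    ∃ c' : V → Fin d, ProperOn G (T ∪ (l ++ [u]).toFinset) c' := by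
  classical
  obtain ⟨c₁, hc₁, h₁⟩ := ProperOn.extend_path hdeg l hc hl hnd hT
  have hu : u ∉ T ∪ l.toFinset := by
    have := hT u (by simp)
    rw [List.nodup_append] at hnd
    grind [List.mem_toFinset]
  obtain ⟨c₂, hc₂, -⟩ := hc₁.exists_insert hu (by
    refine lt_of_lt_of_le (lt_of_le_of_ne Finset.card_image_le fun h ↦ ?_)
      (card_filter_adj_le hdeg (T ∪ l.toFinset) u)
    exact hpq (Finset.card_image_iff.1 h (by simp [hp, hup]) (by simp [hq, huq])
      ((h₁ p hp).trans (hcpq.trans (h₁ q hq).symm))))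
  refine ⟨c₂, ?_⟩
  convert hc₂ using 1
  ext; simp

/-- Every path in a finite set `S` extends, at its head, to one whose head has no further neighbor
in `S`. -/
lemma exists_maximal_path (S : Finset V) (L : List V) (hL : L ≠ []) (hch : L.IsChain G.Adj)
    (hnd : L.Nodup) (hS : ∀ x ∈ L, x ∈ S) :
    ∃ l : List V, (l ++ L).IsChain G.Adj ∧ (l ++ L).Nodup ∧ (∀ x ∈ l ++ L, x ∈ S) ∧
      ∀ x ∈ (l ++ L).head?, ∀ y ∈ S, G.Adj x y → y ∈ l ++ L := by
  classical
  have hcard : L.length ≤ S.card := by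
    rw [← List.toFinset_card_of_nodup hnd]
    exact Finset.card_le_card fun x hx ↦ hS x (by simpa using hx)
  induction hn : S.card - L.length generalizing L with
  | zero =>
    have : L.toFinset = S := Finset.eq_of_subset_of_card_le
      (fun x hx ↦ hS x (by simpa using hx)) (by rw [List.toFinset_card_of_nodup hnd]; omega)
    exact ⟨[], hch, hnd, hS, fun x _ y hy _ ↦ by simpa [← this] using hy⟩
  | succ n ih =>
    by_cases h : ∀ x ∈ L.head?, ∀ y ∈ S, G.Adj x y → y ∈ L
    · exact ⟨[], hch, hnd, hS, h⟩
    push Not at h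
    obtain ⟨x, hx, y, hy, hxy, hyL⟩ := h
    obtain ⟨l, h⟩ := ih (y :: L) (by simp)
      (List.isChain_cons.2 ⟨fun z hz ↦ by
        rw [Option.mem_unique hz hx]; exact hxy.symm, hch⟩)
      (List.nodup_cons.2 ⟨hyL, hnd⟩) (by simpa [hy] using hS) (by simp; omega) (by simp; omega)
    exact ⟨l ++ [y], by simpa using h⟩

/-- Brooks' theorem on a vertex set covered by a path ending in `b, v, a`, where `a` and `b` are
not adjacent and `v` has a further neighbor. -/
lemma exists_properOn_of_spanning_path [DecidableEq V] (hd : 0 < d)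
    (hdeg : ∀ v, (G.neighborSet v).Finite ∧ (G.neighborSet v).ncard ≤ d) {l₁ l₂ : List V}
    {a b v w : V} (hch : (l₂ ++ w :: l₁ ++ [b, v, a]).IsChain G.Adj)
    (hnd : (l₂ ++ w :: l₁ ++ [b, v, a]).Nodup) (hab : ¬ G.Adj a b) (hvw : G.Adj v w) :
    ∃ c : V → Fin d, ProperOn G (l₂ ++ w :: l₁ ++ [b, v, a]).toFinset c := by
  have hbva : [b, v, a].IsChain G.Adj := hch.right_of_append
  have hbv : G.Adj b v := by simp at hbva; exact hbva.1
  have hva : G.Adj v a := by simp at hbva; exact hbva.2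
  have hc₀ : ProperOn G {a, b} (fun _ ↦ (⟨0, hd⟩ : Fin d)) := by
    intro x hx y hy hxy
    simp only [Finset.mem_insert, Finset.mem_singleton] at hx hy
    have := hxy.symm
    have := hxy.ne
    grind
  have hwl : (w :: l₁).IsChain G.Adj := hch.left_of_append.right_of_append
  have hlw : (l₂ ++ [w]).IsChain G.Adj := by
    have h := hch.left_of_append
    rw [List.append_cons] at h
    exact h.left_of_append
  have hrev : ∀ l : List V, l.IsChain G.Adj → l.reverse.IsChain G.Adj := fun l hl ↦ by
    rw [List.isChain_reverse]
    exact hl.imp fun _ _ h ↦ h.symm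
  simp only [List.nodup_append, List.nodup_cons, List.mem_append, List.mem_cons] at hnd
  obtain ⟨c₁, hc₁, h₁⟩ := ProperOn.extend_path hdeg (u := w) l₁.reverse hc₀
    (by simpa using hrev _ hwl)
    (by simp [List.nodup_append]; grind) (by simp; grind)
  obtain ⟨c₂, hc₂⟩ := ProperOn.extend_path_of_eq hdeg (u := v) (p := a) (q := b)
    (l := l₂ ++ [w]) hc₁
    (by
      rw [List.isChain_append]
      exact ⟨hlw, by simp, by simpa using hvw.symm⟩)
    (by simp [List.nodup_append]; grind) (by simp; grind) (by simp) (by simp) (by grind) hva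
    hbv.symm ((h₁ a (by simp)).trans (h₁ b (by simp)).symm)
  refine ⟨c₂, ?_⟩
  convert hc₂ using 1
  ext; simp; tauto

/-- If a proper coloring is given outside a cycle, and some but not all vertices of the cycle have
a neighbor outside, then the whole set can be properly colored. -/
lemma exists_properOn_of_cycle [DecidableEq V]
    (hdeg : ∀ v, (G.neighborSet v).Finite ∧ (G.neighborSet v).ncard ≤ d) {T : Finset V}
    {c : V → Fin d} (hc : ProperOn G T c) {C : List V} (hC : C ≠ []) (hch : C.IsChain G.Adj)
    (hnd : C.Nodup) (hclose : G.Adj (C.getLast hC) (C.head hC)) (hT : ∀ x ∈ C, x ∉ T)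
    (hhead : ∀ y ∈ T, ¬ G.Adj (C.head hC) y) (hout : ∃ x ∈ C, ∃ y ∈ T, G.Adj x y) :
    ∃ c' : V → Fin d, ProperOn G (T ∪ C.toFinset) c' := by
  classical
  obtain ⟨A, y, w, B, rfl, hy, u, hu, hwu⟩ : ∃ A y w B, C = A ++ y :: w :: B ∧
      (∀ z ∈ T, ¬ G.Adj y z) ∧ ∃ u ∈ T, G.Adj w u := by
    clear hclose hnd hT hch
    induction C with
    | nil => exact absurd rfl hC
    | cons x C ih =>
      cases C with
      | nil => simp at hhead hout; grind
      | cons z C =>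
        by_cases hz : ∃ u ∈ T, G.Adj z u
        · exact ⟨[], x, z, C, rfl, by simpa using hhead, hz⟩
        · obtain ⟨A, y, w, B, h, h'⟩ := ih (by simp) (by simpa using hz) (by
            simp only [List.head_cons] at hhead
            grind)
          exact ⟨x :: A, y, w, B, by simp [h], h'⟩
  have hyw : (y :: w :: B).IsChain G.Adj := hch.right_of_append
  have hadj : G.Adj y w := by simp at hyw; exact hyw.1
  have hyT : y ∉ T := hT y (by simp)
  have huy : u ≠ y := by rintro rfl; exact hyT hu
  have hc₁ := hc.insert_update hyT (k := c u) fun z hz h ↦ absurd h (hy z hz)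
  have hpath : ((w :: B) ++ A).IsChain G.Adj := by
    refine List.isChain_append.2 ⟨hyw.tail, hch.left_of_append, fun s hs t ht ↦ ?_⟩
    cases A with
    | nil => simp at ht
    | cons t' A =>
      have hclose : G.Adj ((w :: B).getLast (by simp)) t' := by simpa using hclose
      rw [List.getLast?_eq_getLast_of_ne_nil (by simp)] at hs
      simp only [List.head?_cons, Option.mem_def, Option.some.injEq] at hs ht
      subst hs ht
      exact hclose
  simp only [List.nodup_append, List.nodup_cons, List.mem_append, List.mem_cons] at hnd hT
  obtain ⟨c₂, hc₂⟩ := ProperOn.extend_path_of_eq hdeg (u := w) (p := u) (q := y)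
    (l := (B ++ A).reverse) hc₁
    (by
      have : (B ++ A).reverse ++ [w] = ((w :: B) ++ A).reverse := by simp
      rw [this, List.isChain_reverse]
      exact hpath.imp fun _ _ h ↦ h.symm)
    (by simp [List.nodup_append]; grind) (by simp; grind) (by simp [hu]) (by simp) huy hwu
    hadj.symm (by rw [Function.update_self, Function.update_of_ne huy])
  refine ⟨c₂, ?_⟩
  convert hc₂ using 1
  ext; simp; tauto

/-- **Brooks' theorem** for finite induced subgraphs. -/
theorem exists_properOn_of_cliqueFree (hd : 3 ≤ d)
    (hdeg : ∀ v, (G.neighborSet v).Finite ∧ (G.neighborSet v).ncard ≤ d)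
    (hclique : G.CliqueFree (d + 1)) (S : Finset V) :
    ∃ c : V → Fin d, ProperOn G S c := by
  classical
  induction S using Finset.strongInduction with
  | H S ih =>
  by_contra hS
  have hcard : ∀ v ∈ S, (S.filter (G.Adj v)).card = d := fun v hv ↦ by
    refine (card_filter_adj_le hdeg S v).antisymm (not_lt.1 fun hlt ↦ hS ?_)
    obtain ⟨c, hc⟩ := ih _ (Finset.erase_ssubset hv)
    obtain ⟨c', hc', -⟩ := hc.exists_insert (Finset.notMem_erase v S)
      (Finset.card_image_le.trans_lt (lt_of_le_of_lt
        (Finset.card_le_card (Finset.filter_subset_filter _ (Finset.erase_subset v S))) hlt))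
    exact ⟨c', by rwa [Finset.insert_erase hv] at hc'⟩
  obtain ⟨v, hv⟩ : S.Nonempty := by
    rw [Finset.nonempty_iff_ne_empty]
    rintro rfl
    exact hS ⟨fun _ ↦ ⟨0, by omega⟩, by simp [ProperOn]⟩
  obtain ⟨a, haS, hva, b, hbS, hvb, hab, hnab⟩ : ∃ a ∈ S, G.Adj v a ∧ ∃ b ∈ S, G.Adj v b ∧
      a ≠ b ∧ ¬ G.Adj a b := by
    by_contra! h
    refine hclique (insert v (S.filter (G.Adj v))) ⟨?_, ?_⟩
    · intro x hx y hy hxy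
      simp only [Finset.coe_insert, Finset.coe_filter, Set.mem_insert_iff, Set.mem_ofPred_eq]
        at hx hy
      have := fun z (h : G.Adj v z) ↦ h.symm
      grind
    · rw [Finset.card_insert_of_notMem (by simp), hcard v hv]
  obtain ⟨l, hch, hnd, hlS, hmax⟩ := exists_maximal_path (G := G) S [b, v, a] (by simp)
    (by simp [hvb.symm, hva]) (by simp [hvb.ne', hva.ne, hab.symm]) (by simp [*])
  by_cases hcover : (l ++ [b, v, a]).toFinset = S
  · obtain ⟨w, hw, hwab⟩ := Finset.exists_mem_notMem_of_card_lt_card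
      (s := {a, b}) (t := S.filter (G.Adj v))
      (Finset.card_le_two.trans_lt (by rw [hcard v hv]; omega))
    rw [Finset.mem_filter] at hw
    have hwl : w ∈ l := by
      have hmem := hw.1
      have hne := hw.2.ne'
      simp only [← hcover, List.mem_toFinset, List.mem_append, List.mem_cons, List.not_mem_nil,
        Finset.mem_insert, Finset.mem_singleton] at hmem hwab
      tauto
    obtain ⟨l₂, l₁, rfl⟩ := List.append_of_mem hwl
    exact hS (hcover ▸ exists_properOn_of_spanning_path (by omega) hdeg hch hnd hnab hw.2)
  obtain ⟨x, P, hP⟩ := List.exists_cons_of_ne_nil (l := l ++ [b, v, a]) (by simp)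
  rw [hP] at hch hnd hlS hmax hcover
  have hmax : ∀ y ∈ S, G.Adj x y → y ∈ x :: P := hmax x (by simp)
  have hxS := hlS x (by simp)
  obtain ⟨z, hz⟩ : (S.filter (G.Adj x)).Nonempty := by
    rw [← Finset.card_pos, hcard x hxS]; omega
  rw [Finset.mem_filter] at hz
  obtain ⟨Q₁, z, Q₂, rfl, hxz, hQ₂⟩ : ∃ Q₁ z Q₂, P = Q₁ ++ z :: Q₂ ∧ G.Adj x z ∧
      ∀ y ∈ Q₂, ¬ G.Adj x y := by
    have hzP : ∃ z ∈ P, G.Adj x z :=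
      ⟨z, (List.mem_cons.1 (hmax z hz.1 hz.2)).resolve_left hz.2.ne', hz.2⟩
    clear * - hzP
    induction P with
    | nil => simp at hzP
    | cons p P ih =>
      by_cases h : ∃ z ∈ P, G.Adj x z
      · obtain ⟨Q₁, z, Q₂, h, h'⟩ := ih h
        exact ⟨p :: Q₁, z, Q₂, by simp [h], h'⟩
      · exact ⟨[], p, P, rfl, by grind, by grind⟩
  have hsplit : x :: (Q₁ ++ z :: Q₂) = (x :: (Q₁ ++ [z])) ++ Q₂ := by simp
  rw [hsplit] at hch hnd hlS hmax hcover
  set C := x :: (Q₁ ++ [z]) with hCdef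
  have hCS : C.toFinset ⊆ S := fun y hy ↦ hlS y (by simp at hy ⊢; tauto)
  have hxC : x ∈ C.toFinset := by simp [hCdef]
  obtain ⟨c, hc⟩ := ih (S \ C.toFinset) (Finset.sdiff_ssubset hCS ⟨x, hxC⟩)
  by_cases hout : ∃ y ∈ C, ∃ w ∈ S \ C.toFinset, G.Adj y w
  · obtain ⟨c', hc'⟩ := exists_properOn_of_cycle hdeg hc (C := C) (by simp [hCdef])
      hch.left_of_append hnd.of_append_left (by simpa [hCdef] using hxz.symm)
      (fun y hy h ↦ (Finset.mem_sdiff.1 h).2 (by simpa using hy))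
      (by
        intro y hy hxy
        simp only [hCdef, List.head_cons] at hxy
        rw [Finset.mem_sdiff, List.mem_toFinset] at hy
        exact hQ₂ y ((List.mem_append.1 (hmax y hy.1 hxy)).resolve_left hy.2) hxy) hout
    exact hS ⟨c', by rwa [Finset.sdiff_union_of_subset hCS] at hc'⟩
  · push Not at hout
    have hne : C.toFinset ≠ S := by
      intro h
      refine hcover (Finset.Subset.antisymm (fun y hy ↦ hlS y (by simpa using hy)) ?_)
      rw [← h]
      intro y hy
      simp at hy ⊢
      tauto
    obtain ⟨e, he⟩ := ih _ (hCS.ssubset_of_ne hne)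
    obtain ⟨c', hc'⟩ := he.union hc (fun y hy ↦ hout y (by simpa using hy))
    exact hS ⟨c', by rwa [Finset.union_sdiff_of_subset hCS] at hc'⟩

end Degree

theorem stmt2 {V : Type} [Countable V] (G : SimpleGraph V) (d : ℕ) (hd : 3 ≤ d)
    (hdeg : ∀ v : V, (G.neighborSet v).Finite ∧ (G.neighborSet v).ncard ≤ d)
    (hclique : G.CliqueFree (d + 1)) :
    ∃ c : V → Fin d, ∀ x y : V, G.Adj x y → c x ≠ c y := by
  classical
  choose g hg using exists_properOn_of_cliqueFree hd hdeg hclique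
  obtain ⟨c, hc⟩ := Finset.rado_selection g
  refine ⟨c, fun x y hxy ↦ ?_⟩
  obtain ⟨T, hT, hcT⟩ := hc {x, y}
  rw [hcT x (by simp), hcT y (by simp)]
  exact hg T x (hT (by simp)) y (hT (by simp)) hxy
end

section
/- Let d ≥ 2 and let G = (V,E) be a countable simple graph in which every vertex has degree at most d and which contains no clique on d+1 vertices. Then there exists a d-regular countable simple graph G' = (V',E') which contains no clique on d+1 vertices, a subset U' ⊆ V', and a function h : V → U' which is a graph isomorphism between G and the subgraph of G' induced by U'. -/
/-- Copies of `G` indexed by the vectors in `(ZMod 2)^d`; the copies of a vertex `v` are joined to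
each other along the first `m v` coordinate directions. -/
def SimpleGraph.cubeExtension {V : Type*} (G : SimpleGraph V) (d : ℕ) (m : V → ℕ) :
    SimpleGraph (V × (Fin d → ZMod 2)) where
  Adj p q := (G.Adj p.1 q.1 ∧ p.2 = q.2) ∨
    (p.1 = q.1 ∧ ∃ i : Fin d, (i : ℕ) < m p.1 ∧ q.2 = p.2 + Pi.single i 1)
  symm := ⟨by
    rintro ⟨v, s⟩ ⟨w, t⟩ (⟨h, h'⟩ | ⟨h, i, hi, h'⟩)
    · exact Or.inl ⟨h.symm, h'.symm⟩
    · dsimp only at h h' hi ⊢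
      subst h h'
      exact Or.inr ⟨rfl, i, hi, by
        rw [add_assoc, ← Pi.single_add, CharTwo.add_self_eq_zero, Pi.single_zero, add_zero]⟩⟩
  loopless := ⟨by
    rintro ⟨v, s⟩ (⟨h, -⟩ | ⟨-, i, -, h⟩)
    · exact G.irrefl h
    · simp at h⟩

namespace SimpleGraph

variable {V : Type*} {G : SimpleGraph V} {d : ℕ} {m : V → ℕ}

theorem cubeExtension_adj {p q : V × (Fin d → ZMod 2)} :
    (G.cubeExtension d m).Adj p q ↔ (G.Adj p.1 q.1 ∧ p.2 = q.2) ∨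
      (p.1 = q.1 ∧ ∃ i : Fin d, (i : ℕ) < m p.1 ∧ q.2 = p.2 + Pi.single i 1) :=
  Iff.rfl

theorem cubeExtension_adj_zero {v w : V} :
    (G.cubeExtension d m).Adj (v, 0) (w, 0) ↔ G.Adj v w := by
  simp [cubeExtension_adj, eq_comm (a := (0 : Fin d → ZMod 2))]

/-- An edge inside a copy of the cube changes the parity of the coordinate sum. -/
theorem cubeExtension_sum_eq {p q : V × (Fin d → ZMod 2)} (h : (G.cubeExtension d m).Adj p q)
    (hpq : p.1 = q.1) : ∑ j, q.2 j = ∑ j, p.2 j + 1 := by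
  rcases h with ⟨h, -⟩ | ⟨-, i, -, h⟩
  · exact absurd hpq h.ne
  · simp [h, Finset.sum_add_distrib]

theorem cubeExtension_fst_eq {p q : V × (Fin d → ZMod 2)} (h : (G.cubeExtension d m).Adj p q)
    (hpq : p.2 ≠ q.2) : p.1 = q.1 :=
  h.elim (fun h => absurd h.2 hpq) And.left

/-- An edge between different copies of `G` lies in no triangle. -/
theorem cubeExtension_snd_eq_of_triangle {p q r : V × (Fin d → ZMod 2)}
    (hpq : (G.cubeExtension d m).Adj p q) (hqr : (G.cubeExtension d m).Adj q r)
    (hpr : (G.cubeExtension d m).Adj p r) : p.2 = q.2 := by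
  by_contra hne
  have h1 := cubeExtension_fst_eq hpq hne
  have h2 : p.1 = r.1 := by
    by_cases h : p.2 = r.2
    · exact h1.trans (cubeExtension_fst_eq hqr fun h' => hne (h.trans h'.symm))
    · exact cubeExtension_fst_eq hpr h
  have e1 := cubeExtension_sum_eq hpq h1
  have e2 := cubeExtension_sum_eq hqr (h1.symm.trans h2)
  have e3 := cubeExtension_sum_eq hpr h2
  rw [e2, e1, add_assoc] at e3
  exact absurd (add_left_cancel e3) (by decide)

theorem CliqueFree.cubeExtension {n : ℕ} (hn : 3 ≤ n) (hG : G.CliqueFree n) :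
    (G.cubeExtension d m).CliqueFree n := by
  classical
  intro S hS
  have hadj := hS.isClique
  obtain ⟨p, hp⟩ : S.Nonempty := Finset.card_pos.1 (by rw [hS.card_eq]; omega)
  have hsnd : ∀ q ∈ S, p.2 = q.2 := by
    intro q hq
    by_cases hpq : p = q
    · rw [hpq]
    obtain ⟨r, hr, hr'⟩ := Finset.exists_mem_notMem_of_card_lt_card
      (s := {p, q}) (t := S) (Finset.card_le_two.trans_lt (by rw [hS.card_eq]; omega))
    simp only [Finset.mem_insert, Finset.mem_singleton, not_or] at hr'
    exact cubeExtension_snd_eq_of_triangle (hadj hp hq hpq) (hadj hq hr (Ne.symm hr'.2))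
      (hadj hp hr (Ne.symm hr'.1))
  have hinj : Set.InjOn Prod.fst (S : Set (V × (Fin d → ZMod 2))) := fun q hq r hr h =>
    Prod.ext h ((hsnd q hq).symm.trans (hsnd r hr))
  refine hG (S.image Prod.fst) ⟨?_, by rw [Finset.card_image_of_injOn hinj, hS.card_eq]⟩
  rw [Finset.coe_image]
  rintro _ ⟨q, hq, rfl⟩ _ ⟨r, hr, rfl⟩ hne
  rcases hadj hq hr fun h => hne (congrArg _ h) with h | h
  · exact h.1
  · exact absurd h.1 hne

theorem ncard_neighborSet_cubeExtension (p : V × (Fin d → ZMod 2))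
    (hfin : (G.neighborSet p.1).Finite) (hm : m p.1 ≤ d) :
    ((G.cubeExtension d m).neighborSet p).ncard = (G.neighborSet p.1).ncard + m p.1 := by
  obtain ⟨v, s⟩ := p
  dsimp only at hfin hm ⊢
  have hunion : (G.cubeExtension d m).neighborSet (v, s) =
      (fun w => (w, s)) '' G.neighborSet v ∪
        (fun i : Fin (m v) => (v, s + Pi.single (Fin.castLE hm i) 1)) '' Set.univ := by
    ext ⟨w, t⟩
    simp only [mem_neighborSet, cubeExtension_adj, Set.mem_union, Set.mem_image, Prod.mk.injEq,
      Set.mem_univ, true_and]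
    refine or_congr ⟨fun h => ⟨w, h.1, rfl, h.2⟩, ?_⟩ ⟨?_, ?_⟩
    · rintro ⟨_, h, rfl, rfl⟩
      exact ⟨h, rfl⟩
    · rintro ⟨rfl, i, hi, rfl⟩
      exact ⟨⟨i, hi⟩, rfl, rfl⟩
    · rintro ⟨i, rfl, rfl⟩
      exact ⟨rfl, Fin.castLE hm i, i.2, rfl⟩
  have hdisj : Disjoint ((fun w => (w, s)) '' G.neighborSet v)
      ((fun i : Fin (m v) => (v, s + Pi.single (Fin.castLE hm i) (1 : ZMod 2))) '' Set.univ) := by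
    rw [Set.disjoint_left]
    rintro _ ⟨w, hw, rfl⟩ ⟨i, -, h⟩
    exact (G.ne_of_adj hw) (congrArg Prod.fst h)
  have hinj : Function.Injective
      fun i : Fin (m v) => (v, s + Pi.single (Fin.castLE hm i) (1 : ZMod 2)) := by
    intro i j h
    have h' := congrFun (add_left_cancel (congrArg Prod.snd h)) (Fin.castLE hm i)
    by_contra hij
    rw [Pi.single_eq_same, Pi.single_eq_of_ne fun h => hij (Fin.castLE_injective hm h)] at h'
    exact one_ne_zero h'
  rw [hunion, Set.ncard_union_eq hdisj (hfin.image _) (Set.toFinite _),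
    Set.ncard_image_of_injective _ (Prod.mk_left_injective s), Set.ncard_image_of_injective _ hinj,
    Set.ncard_univ, Nat.card_fin]

end SimpleGraph

theorem stmt5 {V : Type} [Countable V] (G : SimpleGraph V) (d : ℕ) (hd : 2 ≤ d)
    (hdeg : ∀ v : V, (G.neighborSet v).Finite ∧ (G.neighborSet v).ncard ≤ d)
    (hclique : G.CliqueFree (d + 1)) :
    ∃ (V' : Type) (G' : SimpleGraph V'), Countable V' ∧
      (∀ v : V', (G'.neighborSet v).ncard = d) ∧
      G'.CliqueFree (d + 1) ∧
      ∃ (U' : Set V') (h : V → V'), Set.range h = U' ∧ Function.Injective h ∧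
        ∀ x y : V, G.Adj x y ↔ G'.Adj (h x) (h y) := by
  refine ⟨V × (Fin d → ZMod 2), G.cubeExtension d fun v => d - (G.neighborSet v).ncard,
    inferInstance, fun p => ?_, hclique.cubeExtension (by omega), _, fun v => (v, 0), rfl,
    Prod.mk_left_injective 0, fun x y => SimpleGraph.cubeExtension_adj_zero.symm⟩
  rw [SimpleGraph.ncard_neighborSet_cubeExtension p (hdeg p.1).1 (Nat.sub_le _ _)]
  exact Nat.add_sub_of_le (hdeg p.1).2
end

section
/- Let T be a circle-tree determined by circles C(0),…,C(k−1), and let C be a set of vertices of T whose induced subgraph in T is a circle. Then there is j < k such that C = C(j). -/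
/-- `C` is a circle in `G`: a finite set of vertices whose induced subgraph is connected
and in which every vertex has exactly two neighbors within `C`. -/
def IsCircleIn {V : Type*} (G : SimpleGraph V) (C : Set V) : Prop :=
  C.Finite ∧ (G.induce C).Connected ∧ ∀ x ∈ C, (G.neighborSet x ∩ C).ncard = 2

/-- The sequence of pairwise disjoint circles `C 0, …, C (k-1)` determines the induced
subgraph of `G` on `T` as a circle-tree: `T` is the union of the circles, and for each
`0 < j < k`, the graph built from the circles `C 0, …, C (j-1)` is joined to the circle
`C j` by exactly one edge, whose endpoint in the earlier part has degree `2` there. -/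
def Determines {V : Type*} (G : SimpleGraph V) (T : Set V) (k : ℕ) (C : ℕ → Set V) : Prop :=
  0 < k ∧
  (∀ i, i < k → IsCircleIn G (C i)) ∧
  (∀ i j, i < k → j < k → i ≠ j → Disjoint (C i) (C j)) ∧
  (⋃ i ∈ Set.Iio k, C i) = T ∧
  ∀ j, 0 < j → j < k →
    (∃! p : V × V, p.1 ∈ (⋃ i ∈ Set.Iio j, C i) ∧ p.2 ∈ C j ∧ G.Adj p.1 p.2) ∧
    (∀ x y : V, x ∈ (⋃ i ∈ Set.Iio j, C i) → y ∈ C j → G.Adj x y →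
      (G.neighborSet x ∩ (⋃ i ∈ Set.Iio j, C i)).ncard = 2)

/-- The induced subgraph of `G` on `T` is a circle-tree. -/
def IsCircleTree {V : Type*} (G : SimpleGraph V) (T : Set V) : Prop :=
  ∃ k C, Determines G T k C

/-- A connected induced subgraph has an edge leaving any proper nonempty part of it. -/
theorem exists_adj_of_induce_connected {V : Type*} {G : SimpleGraph V} {A S : Set V}
    (hA : (G.induce A).Connected) {u v : V} (hu : u ∈ A) (hv : v ∈ A) (huS : u ∈ S)
    (hvS : v ∉ S) : ∃ x ∈ A, ∃ y ∈ A, x ∈ S ∧ y ∉ S ∧ G.Adj x y := by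
  obtain ⟨p⟩ := hA.preconnected ⟨u, hu⟩ ⟨v, hv⟩
  obtain ⟨d, -, hd₁, hd₂⟩ := p.exists_boundary_dart (Subtype.val ⁻¹' S) huS hvS
  exact ⟨d.fst, d.fst.2, d.snd, d.snd.2, hd₁, hd₂, d.adj⟩

/-- A circle contained in a circle is equal to it. -/
theorem IsCircleIn.eq_of_subset {V : Type*} {G : SimpleGraph V} {C D : Set V}
    (hC : IsCircleIn G C) (hD : IsCircleIn G D) (h : D ⊆ C) : D = C := by
  refine h.antisymm fun v hv => ?_
  by_contra hvD
  obtain ⟨u, hu⟩ := hD.2.1.nonempty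
  obtain ⟨x, hxC, y, hyC, hxD, hyD, hxy⟩ :=
    exists_adj_of_induce_connected hC.2.1 (h hu) hv hu hvD
  have heq : G.neighborSet x ∩ D = G.neighborSet x ∩ C :=
    Set.eq_of_subset_of_ncard_le (Set.inter_subset_inter_right _ h)
      (by rw [hC.2.2 x hxC, hD.2.2 x hxD]) (hC.1.subset Set.inter_subset_right)
  have hy : y ∈ G.neighborSet x ∩ C := ⟨hxy, hyC⟩
  rw [← heq] at hy
  exact hyD hy.2

/-- The degree in an induced subgraph counts the neighbors lying in the vertex subset. -/
theorem degree_induce_eq_ncard {V : Type*} (G : SimpleGraph V) (S : Set V) (x : S)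
    [Fintype ((G.induce S).neighborSet x)] :
    (G.induce S).degree x = (G.neighborSet x ∩ S).ncard := by
  have himage : G.neighborSet x ∩ S = Subtype.val '' (G.induce S).neighborSet x := by
    ext y
    simp [and_comm]
  rw [himage, Set.ncard_image_of_injective _ Subtype.val_injective,
    ← SimpleGraph.card_neighborSet_eq_degree, ← Nat.card_eq_fintype_card, Nat.card_coe_set_eq]

open Classical in
/-- By the handshaking lemma, a finite induced subgraph cannot have a single odd vertex. -/
theorem exists_ne_odd_ncard_neighborSet_inter {V : Type*} (G : SimpleGraph V) {S : Set V}
    (hS : S.Finite) {a : V} (ha : a ∈ S) (hodd : Odd (G.neighborSet a ∩ S).ncard) :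
    ∃ b ∈ S, b ≠ a ∧ Odd (G.neighborSet b ∩ S).ncard := by
  have := hS.fintype
  obtain ⟨b, hb, hbodd⟩ := (G.induce S).exists_ne_odd_degree_of_exists_odd_degree ⟨a, ha⟩
    (by rwa [degree_induce_eq_ncard])
  rw [degree_induce_eq_ncard] at hbodd
  exact ⟨b, b.2, fun h => hb (Subtype.ext h), hbodd⟩

/-- A circle covered by two parts that are joined by at most one edge avoids the second part
or is contained in it. -/
theorem IsCircleIn.disjoint_or_subset {V : Type*} {G : SimpleGraph V} {D A B : Set V}
    (hD : IsCircleIn G D) (hDAB : D ⊆ A ∪ B) {a b : V}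
    (hab : ∀ x ∈ A, ∀ y ∈ B, G.Adj x y → x = a ∧ y = b) : Disjoint D B ∨ D ⊆ B := by
  by_contra! ⟨hdisj, hsub⟩
  obtain ⟨u, huD, huB⟩ := Set.not_disjoint_iff.1 hdisj
  obtain ⟨v, hvD, hvB⟩ := Set.not_subset.1 hsub
  obtain ⟨y, hyD, x, hxD, hyB, hxB, hyx⟩ :=
    exists_adj_of_induce_connected hD.2.1 huD hvD huB hvB
  have hA : ∀ z ∈ D, z ∉ B → z ∈ A := fun z hz hzB => (hDAB hz).resolve_right hzB
  obtain ⟨rfl, rfl⟩ := hab x (hA x hxD hxB) y hyB hyx.symm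
  have hy : G.neighborSet y ∩ (D ∩ B) = (G.neighborSet y ∩ D) \ {x} := by
    ext z
    constructor
    · rintro ⟨hz, hzD, hzB⟩
      exact ⟨⟨hz, hzD⟩, fun h => hxB (h ▸ hzB)⟩
    · rintro ⟨⟨hz, hzD⟩, hzx⟩
      refine ⟨hz, hzD, by_contra fun hzB => hzx ?_⟩
      exact (hab z (hA z hzD hzB) y hyB (G.adj_symm hz)).1
  have hodd : Odd (G.neighborSet y ∩ (D ∩ B)).ncard := by
    have hx : x ∈ G.neighborSet y ∩ D := ⟨hyx, hxD⟩
    rw [hy, Set.ncard_sdiff_singleton_of_mem hx, hD.2.2 y hyD]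
    exact odd_one
  obtain ⟨z, ⟨hzD, hzB⟩, hzy, hzodd⟩ := exists_ne_odd_ncard_neighborSet_inter G
    (hD.1.subset Set.inter_subset_left) ⟨hyD, hyB⟩ hodd
  have hz : G.neighborSet z ∩ (D ∩ B) = G.neighborSet z ∩ D := by
    refine Set.Subset.antisymm (fun w hw => ⟨hw.1, hw.2.1⟩) fun w hw => ?_
    refine ⟨hw.1, hw.2, by_contra fun hwB => hzy ?_⟩
    exact (hab w (hA w hw.2 hwB) z hzB (G.adj_symm hw.1)).2
  rw [hz, hD.2.2 z hzD] at hzodd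
  exact absurd hzodd (by decide)

theorem stmt8 {V : Type} (G : SimpleGraph V) (T : Set V) (k : ℕ) (C : ℕ → Set V)
    (h : Determines G T k C) (D : Set V) (hD : D ⊆ T) (hcirc : IsCircleIn G D) :
    ∃ j < k, D = C j := by
  obtain ⟨-, hC, -, rfl, hedge⟩ := h
  suffices H : ∀ n ≤ k, D ⊆ ⋃ i ∈ Set.Iio n, C i → ∃ j < n, D = C j from H k le_rfl hD
  intro n
  induction n with
  | zero =>
    intro _ hsub
    obtain ⟨u, hu⟩ := hcirc.2.1.nonempty
    simpa using hsub hu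
  | succ n ih =>
    intro hn hsub
    have hcover : D ⊆ (⋃ i ∈ Set.Iio n, C i) ∪ C n := by
      intro x hx
      obtain ⟨i, hi, hxi⟩ := Set.mem_iUnion₂.1 (hsub hx)
      rcases Nat.lt_succ_iff_lt_or_eq.1 hi with hlt | rfl
      · exact Or.inl (Set.mem_biUnion hlt hxi)
      · exact Or.inr hxi
    have hdich : Disjoint D (C n) ∨ D ⊆ C n := by
      rcases Nat.eq_zero_or_pos n with rfl | hpos
      · exact Or.inr (by simpa using hcover)
      · obtain ⟨⟨p, -, hp⟩, -⟩ := hedge n hpos hn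
        refine hcirc.disjoint_or_subset hcover (a := p.1) (b := p.2) fun x hx y hy hxy => ?_
        simp [← hp (x, y) ⟨hx, hy, hxy⟩]
    rcases hdich with hdisj | hDn
    · obtain ⟨j, hj, rfl⟩ := ih (Nat.le_of_succ_le hn) (hdisj.subset_left_of_subset_union hcover)
      exact ⟨j, hj.trans n.lt_succ_self, rfl⟩
    · exact ⟨n, n.lt_succ_self, (hC n hn).eq_of_subset hcirc hDn⟩
end

section
/- Let T be a circle-tree with vertex set of cardinality |T|. Then 3·|{x ∈ T : deg_T(x) = 2}| > |T|, and hence 2·|{x ∈ T : deg_T(x) = 2}| > |{x ∈ T : deg_T(x) = 3}|. -/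
/-- A circle has at least three vertices. -/
theorem IsCircleIn.three_le_ncard {V : Type*} {G : SimpleGraph V} {C : Set V}
    (h : IsCircleIn G C) : 3 ≤ C.ncard := by
  obtain ⟨hfin, hconn, hdeg⟩ := h
  obtain ⟨x, hx⟩ := hconn.nonempty
  have hx' : x ∉ G.neighborSet x ∩ C := fun h => G.irrefl h.1
  have hsub : insert x (G.neighborSet x ∩ C) ⊆ C :=
    Set.insert_subset hx Set.inter_subset_right
  have hle := Set.ncard_le_ncard hsub hfin
  rwa [Set.ncard_insert_of_notMem hx' (hfin.subset Set.inter_subset_right), hdeg x hx] at hle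

/-- The vertex and degree counts satisfied by the union of `m` circles in a circle-tree. -/
structure DegreeBounds {V : Type*} (G : SimpleGraph V) (U : Set V) (m : ℕ) : Prop where
  finite : U.Finite
  degree : ∀ x ∈ U, (G.neighborSet x ∩ U).ncard = 2 ∨ (G.neighborSet x ∩ U).ncard = 3
  ncard_three : {x ∈ U | (G.neighborSet x ∩ U).ncard = 3}.ncard + 2 ≤ 2 * m
  le_ncard : 3 * m ≤ U.ncard

theorem IsCircleIn.degreeBounds {V : Type*} {G : SimpleGraph V} {C : Set V}
    (h : IsCircleIn G C) : DegreeBounds G C 1 where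
  finite := h.1
  degree x hx := .inl (h.2.2 x hx)
  ncard_three := by
    have hempty : {x ∈ C | (G.neighborSet x ∩ C).ncard = 3} = ∅ := by
      ext x
      simp only [Set.mem_ofPred_eq, Set.mem_empty_iff_false, iff_false, not_and]
      intro hx
      simp [h.2.2 x hx]
    simp [hempty]
  le_ncard := by simpa using h.three_le_ncard

/-- Attaching a circle by a single edge at a vertex of degree two preserves the counts. -/
theorem DegreeBounds.union_circle {V : Type*} {G : SimpleGraph V} {U C : Set V} {m : ℕ}
    (hU : DegreeBounds G U m) (hC : IsCircleIn G C) (hdisj : Disjoint U C)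
    (hedge : ∃! p : V × V, p.1 ∈ U ∧ p.2 ∈ C ∧ G.Adj p.1 p.2)
    (hdeg : ∀ x y : V, x ∈ U → y ∈ C → G.Adj x y → (G.neighborSet x ∩ U).ncard = 2) :
    DegreeBounds G (U ∪ C) (m + 1) := by
  obtain ⟨⟨a, b⟩, ⟨ha, hb, hab⟩, huniq⟩ := hedge
  dsimp only at ha hb hab
  have hedge_eq : ∀ x y, x ∈ U → y ∈ C → G.Adj x y → x = a ∧ y = b := fun x y hx hy hxy =>
    Prod.mk.inj (huniq (x, y) ⟨hx, hy, hxy⟩)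
  have haC : a ∉ C := Set.disjoint_left.mp hdisj ha
  have hbU : b ∉ U := Set.disjoint_right.mp hdisj hb
  have hda : (G.neighborSet a ∩ (U ∪ C)).ncard = 3 := by
    have : G.neighborSet a ∩ (U ∪ C) = insert b (G.neighborSet a ∩ U) := by
      ext y
      simp only [Set.mem_inter_iff, Set.mem_union, Set.mem_insert_iff, SimpleGraph.mem_neighborSet]
      grind
    rw [this, Set.ncard_insert_of_notMem (fun h => hbU h.2)
      (hU.finite.subset Set.inter_subset_right), hdeg a b ha hb hab]
  have hdb : (G.neighborSet b ∩ (U ∪ C)).ncard = 3 := by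
    have : G.neighborSet b ∩ (U ∪ C) = insert a (G.neighborSet b ∩ C) := by
      ext y
      simp only [Set.mem_inter_iff, Set.mem_union, Set.mem_insert_iff, SimpleGraph.mem_neighborSet]
      have := hab.symm
      have hsymm : G.Adj b y → G.Adj y b := fun h => h.symm
      grind
    rw [this, Set.ncard_insert_of_notMem (fun h => haC h.2)
      (hC.1.subset Set.inter_subset_right), hC.2.2 b hb]
  have hdU : ∀ x ∈ U, x ≠ a → G.neighborSet x ∩ (U ∪ C) = G.neighborSet x ∩ U := by
    intro x hx hxa
    ext y
    simp only [Set.mem_inter_iff, Set.mem_union, SimpleGraph.mem_neighborSet]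
    grind
  have hdC : ∀ x ∈ C, x ≠ b → (G.neighborSet x ∩ (U ∪ C)).ncard = 2 := by
    intro x hx hxb
    rw [← hC.2.2 x hx]
    congr 1
    ext y
    simp only [Set.mem_inter_iff, Set.mem_union, SimpleGraph.mem_neighborSet]
    have hsymm : G.Adj x y → G.Adj y x := fun h => h.symm
    grind
  refine ⟨hU.finite.union hC.1, ?_, ?_, ?_⟩
  · rintro x (hx | hx)
    · by_cases hxa : x = a
      · exact .inr (hxa ▸ hda)
      · rw [hdU x hx hxa]
        exact hU.degree x hx
    · by_cases hxb : x = b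
      · exact .inr (hxb ▸ hdb)
      · exact .inl (hdC x hx hxb)
  · have hsub : {x ∈ U ∪ C | (G.neighborSet x ∩ (U ∪ C)).ncard = 3} ⊆
        insert a (insert b {x ∈ U | (G.neighborSet x ∩ U).ncard = 3}) := by
      rintro x ⟨hx | hx, hx3⟩
      · by_cases hxa : x = a
        · exact .inl hxa
        · exact .inr (.inr ⟨hx, hdU x hx hxa ▸ hx3⟩)
      · by_cases hxb : x = b
        · exact .inr (.inl hxb)
        · have := hdC x hx hxb
          omega
    have hle := Set.ncard_le_ncard hsub (((hU.finite.subset (Set.sep_subset _ _)).insert b).insert a)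
    have h₁ := Set.ncard_insert_le a (insert b {x ∈ U | (G.neighborSet x ∩ U).ncard = 3})
    have h₂ := Set.ncard_insert_le b {x ∈ U | (G.neighborSet x ∩ U).ncard = 3}
    have h₃ := hU.ncard_three
    omega
  · rw [Set.ncard_union_eq hdisj hU.finite hC.1]
    have h₁ := hU.le_ncard
    have h₂ := hC.three_le_ncard
    omega

theorem Determines.degreeBounds {V : Type*} {G : SimpleGraph V} {T : Set V} {k : ℕ}
    {C : ℕ → Set V} (h : Determines G T k C) : DegreeBounds G T k := by
  obtain ⟨hk, hcirc, hdisj, rfl, hstep⟩ := h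
  suffices ∀ j, 1 ≤ j → j ≤ k → DegreeBounds G (⋃ i ∈ Set.Iio j, C i) j from this k hk le_rfl
  intro j hj
  induction j, hj using Nat.le_induction with
  | base =>
    intro _
    have : (⋃ i ∈ Set.Iio 1, C i) = C 0 := by simp
    rw [this]
    exact (hcirc 0 hk).degreeBounds
  | succ j hj ih =>
    intro hjk
    have hunion : (⋃ i ∈ Set.Iio (j + 1), C i) = (⋃ i ∈ Set.Iio j, C i) ∪ C j := by
      simpa only [Set.mem_Iio] using Set.biUnion_lt_succ C j
    rw [hunion]
    refine (ih (by omega)).union_circle (hcirc j hjk) ?_ (hstep j hj hjk).1 (hstep j hj hjk).2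
    simp only [Set.disjoint_iUnion_left, Set.mem_Iio]
    exact fun i hi => hdisj i j (by omega) hjk hi.ne

theorem stmt10 {V : Type} (G : SimpleGraph V) (T : Set V) (h : IsCircleTree G T) :
    3 * {x ∈ T | (G.neighborSet x ∩ T).ncard = 2}.ncard > T.ncard ∧
    2 * {x ∈ T | (G.neighborSet x ∩ T).ncard = 2}.ncard >
      {x ∈ T | (G.neighborSet x ∩ T).ncard = 3}.ncard := by
  obtain ⟨k, C, hC⟩ := h
  have hT := hC.degreeBounds
  have hunion : {x ∈ T | (G.neighborSet x ∩ T).ncard = 2} ∪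
      {x ∈ T | (G.neighborSet x ∩ T).ncard = 3} = T := by
    rw [← Set.sep_or]
    exact Set.sep_eq_self_iff_mem_true.mpr hT.degree
  have hdisj : Disjoint {x ∈ T | (G.neighborSet x ∩ T).ncard = 2}
      {x ∈ T | (G.neighborSet x ∩ T).ncard = 3} :=
    Set.disjoint_left.mpr fun x h₂ h₃ => by
      have := h₂.2.symm.trans h₃.2
      omega
  have hcard := Set.ncard_union_eq hdisj (hT.finite.subset (Set.sep_subset _ _))
    (hT.finite.subset (Set.sep_subset _ _))
  rw [hunion] at hcard
  have h₁ := hT.ncard_three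
  have h₂ := hT.le_ncard
  omega
end

section
/- Let T₁ and T₂ be vertex-disjoint circle-trees, let x be a vertex of T₁ with deg_{T₁}(x) = 2, and let y be a vertex of T₂ with deg_{T₂}(y) = 2. Then the graph obtained as the union of T₁ and T₂ together with one additional edge joining x and y is a circle-tree. -/
/-- The disjoint sets `A` and `B` are joined by exactly one edge of `G`, namely `x y`
with `x ∈ A` and `y ∈ B`. -/
structure JoinedAt {V : Type*} (G : SimpleGraph V) (A B : Set V) (x y : V) : Prop where
  disjoint : Disjoint A B
  left_mem : x ∈ A
  right_mem : y ∈ B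
  adj : G.Adj x y
  eq_of_adj : ∀ a ∈ A, ∀ b ∈ B, G.Adj a b → a = x ∧ b = y

namespace JoinedAt

variable {V : Type*} {G : SimpleGraph V} {A B D : Set V} {x y u v : V}

theorem symm (h : JoinedAt G A B x y) : JoinedAt G B A y x :=
  ⟨h.disjoint.symm, h.right_mem, h.left_mem, h.adj.symm,
    fun a ha b hb hab => (h.eq_of_adj b hb a ha hab.symm).symm⟩

theorem neighborSet_inter_union (h : JoinedAt G A B x y) {a : V} (ha : a ∈ A) (hne : a ≠ x) :
    G.neighborSet a ∩ (A ∪ B) = G.neighborSet a ∩ A := by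
  ext b
  constructor
  · rintro ⟨hab, hb | hb⟩
    · exact ⟨hab, hb⟩
    · exact absurd (h.eq_of_adj a ha b hb hab).1 hne
  · exact fun hb => ⟨hb.1, Or.inl hb.2⟩

theorem neighborSet_inter_union_left (h : JoinedAt G A B x y) :
    G.neighborSet x ∩ (A ∪ B) = insert y (G.neighborSet x ∩ A) := by
  ext b
  constructor
  · rintro ⟨hab, hb | hb⟩
    · exact Or.inr ⟨hab, hb⟩
    · exact Or.inl (h.eq_of_adj x h.left_mem b hb hab).2
  · rintro (rfl | hb)
    · exact ⟨h.adj, Or.inr h.right_mem⟩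
    · exact ⟨hb.1, Or.inl hb.2⟩

/-- The end of the joining edge has one more neighbor in the union, so a vertex whose degree is
the same in the union is not that end. -/
theorem ne_of_ncard_eq (h : JoinedAt G A B x y) {n : ℕ} (hn : n ≠ 0)
    (hx : (G.neighborSet x ∩ A).ncard = n) {a : V}
    (ha : (G.neighborSet a ∩ (A ∪ B)).ncard = n) : a ≠ x := by
  rintro rfl
  have hfin : (G.neighborSet a ∩ A).Finite := Set.finite_of_ncard_ne_zero (hx ▸ hn)
  rw [h.neighborSet_inter_union_left, Set.ncard_insert_of_notMem
    (fun hy => Set.disjoint_left.1 h.disjoint hy.2 h.right_mem) hfin] at ha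
  omega

theorem mono_right (h : JoinedAt G A (B ∪ D) x y) (hy : y ∈ B) : JoinedAt G A B x y :=
  ⟨h.disjoint.mono_right Set.subset_union_left, h.left_mem, hy, h.adj,
    fun a ha b hb => h.eq_of_adj a ha b (Or.inl hb)⟩

/-- If `A` is joined to `B ∪ D` through `B`, and `B` is joined to `D`, then `A ∪ B` is joined
to `D`. -/
theorem union_left (h : JoinedAt G A (B ∪ D) x y) (hy : y ∈ B) (h' : JoinedAt G B D u v) :
    JoinedAt G (A ∪ B) D u v := by
  refine ⟨Set.disjoint_union_left.2 ⟨h.disjoint.mono_right Set.subset_union_right, h'.disjoint⟩,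
    Or.inr h'.left_mem, h'.right_mem, h'.adj, ?_⟩
  rintro a (ha | ha) b hb hab
  · have hby := (h.eq_of_adj a ha b (Or.inr hb) hab).2
    exact absurd hb (Set.disjoint_left.1 h'.disjoint (hby ▸ hy))
  · exact h'.eq_of_adj a ha b hb hab

end JoinedAt

/-- The sets of vertices obtained from a circle by repeatedly joining a further circle at a
vertex of degree `2`. -/
inductive BuiltFromCircles {V : Type*} (G : SimpleGraph V) : Set V → Prop
  | circle {C : Set V} (hC : IsCircleIn G C) : BuiltFromCircles G C
  | join {T C : Set V} {u v : V} (hT : BuiltFromCircles G T) (hC : IsCircleIn G C)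
      (h : JoinedAt G T C u v) (hu : (G.neighborSet u ∩ T).ncard = 2) :
      BuiltFromCircles G (T ∪ C)

section

variable {V : Type*} {G : SimpleGraph V}

theorem biUnion_Iio_succ (C : ℕ → Set V) (n : ℕ) :
    (⋃ i ∈ Set.Iio (n + 1), C i) = (⋃ i ∈ Set.Iio n, C i) ∪ C n := by
  ext a
  simp only [Set.mem_iUnion, Set.mem_Iio, Set.mem_union, Nat.lt_succ_iff_lt_or_eq, exists_prop]
  grind

theorem IsCircleIn.isCircleTree {C : Set V} (hC : IsCircleIn G C) : IsCircleTree G C := by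
  refine ⟨1, fun _ => C, one_pos, fun _ _ => hC, fun i j hi hj hij => by omega, ?_,
    fun j h0 h1 => by omega⟩
  ext a
  simp

theorem IsCircleTree.join {T D : Set V} {u v : V} (hT : IsCircleTree G T) (hD : IsCircleIn G D)
    (h : JoinedAt G T D u v) (hu : (G.neighborSet u ∩ T).ncard = 2) :
    IsCircleTree G (T ∪ D) := by
  obtain ⟨k, C, hk, hcirc, hdisj, rfl, hjoin⟩ := hT
  set E : ℕ → Set V := fun i => if i < k then C i else D with hE
  have hlt : ∀ i, i < k → E i = C i := fun i hi => if_pos hi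
  have hEk : E k = D := if_neg (lt_irrefl k)
  have hU : ∀ j ≤ k, (⋃ i ∈ Set.Iio j, E i) = ⋃ i ∈ Set.Iio j, C i := fun j hj =>
    Set.iUnion₂_congr fun i hi => hlt i (lt_of_lt_of_le hi hj)
  have hCD : ∀ i, i < k → Disjoint (C i) D := fun i hi =>
    h.disjoint.mono_left (Set.subset_biUnion_of_mem (u := C) (Set.mem_Iio.2 hi))
  refine ⟨k + 1, E, k.succ_pos, fun i hi => ?_, fun i j hi hj hij => ?_, ?_, fun j h0 hj => ?_⟩
  · rcases Nat.lt_succ_iff_lt_or_eq.1 hi with hi | rfl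
    · rw [hlt i hi]
      exact hcirc i hi
    · rwa [hEk]
  · rcases Nat.lt_succ_iff_lt_or_eq.1 hi with hi | rfl <;>
      rcases Nat.lt_succ_iff_lt_or_eq.1 hj with hj | rfl
    · rw [hlt i hi, hlt j hj]
      exact hdisj i j hi hj hij
    · rw [hlt i hi, hEk]
      exact hCD i hi
    · rw [hlt j hj, hEk]
      exact (hCD j hj).symm
    · exact absurd rfl hij
  · rw [biUnion_Iio_succ, hU k le_rfl, hEk]
  · rw [hU j (Nat.lt_succ_iff.1 hj)]
    rcases Nat.lt_succ_iff_lt_or_eq.1 hj with hj | rfl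
    · rw [hlt j hj]
      exact hjoin j h0 hj
    · rw [hEk]
      refine ⟨⟨(u, v), ⟨h.left_mem, h.right_mem, h.adj⟩, ?_⟩, fun a b ha hb hab => ?_⟩
      · rintro ⟨a, b⟩ ⟨ha, hb, hab⟩
        exact Prod.ext_iff.2 (h.eq_of_adj a ha b hb hab)
      · rwa [(h.eq_of_adj a ha b hb hab).1]

theorem BuiltFromCircles.isCircleTree {T : Set V} (hT : BuiltFromCircles G T) :
    IsCircleTree G T := by
  induction hT with
  | circle hC => exact hC.isCircleTree
  | join _ hC h hu ih => exact ih.join hC h hu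

theorem IsCircleTree.builtFromCircles {T : Set V} (hT : IsCircleTree G T) :
    BuiltFromCircles G T := by
  obtain ⟨k, C, hk, hcirc, hdisj, rfl, hjoin⟩ := hT
  suffices H : ∀ n < k, BuiltFromCircles G (⋃ i ∈ Set.Iio (n + 1), C i) by
    obtain ⟨n, rfl⟩ := Nat.exists_eq_succ_of_ne_zero hk.ne'
    exact H n n.lt_succ_self
  intro n hn
  rw [biUnion_Iio_succ]
  induction n with
  | zero => simpa using BuiltFromCircles.circle (hcirc 0 hn)
  | succ n ih =>
    obtain ⟨⟨⟨u, v⟩, ⟨hu, hv, huv⟩, huniq⟩, hdeg⟩ := hjoin (n + 1) n.succ_pos hn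
    have hT := ih (by omega)
    rw [← biUnion_Iio_succ] at hT
    refine hT.join (hcirc _ hn) (u := u) (v := v) ⟨?_, hu, hv, huv, fun a ha b hb hab => ?_⟩
      (hdeg u v hu hv huv)
    · exact Set.disjoint_iUnion₂_left.2 fun i hi =>
        hdisj i _ (lt_trans hi hn) hn (ne_of_lt hi)
    · exact Prod.ext_iff.1 (huniq (a, b) ⟨ha, hb, hab⟩)

theorem BuiltFromCircles.union {A B : Set V} {x y : V} (hA : BuiltFromCircles G A)
    (hB : BuiltFromCircles G B) (h : JoinedAt G A B x y)
    (hx : (G.neighborSet x ∩ A).ncard = 2) (hy : (G.neighborSet y ∩ B).ncard = 2) :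
    BuiltFromCircles G (A ∪ B) := by
  induction hB generalizing A x y with
  | circle hC => exact hA.join hC h hx
  | @join T C u v _ hC hTC hu ih =>
    have hv := hC.2.2 v hTC.right_mem
    rcases h.right_mem with hyT | hyC
    · have hyu : y ≠ u := hTC.ne_of_ncard_eq two_ne_zero hu hy
      rw [hTC.neighborSet_inter_union hyT hyu] at hy
      have hAT := h.mono_right hyT
      rw [← Set.union_assoc]
      refine (ih hA hAT hx hy).join hC (h.union_left hyT hTC) ?_
      rwa [Set.union_comm, hAT.symm.neighborSet_inter_union hTC.left_mem hyu.symm]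
    · -- Join `C` to `A` first, and then `T` to `A ∪ C`.
      rw [Set.union_comm T C] at h hy ⊢
      have hyv : y ≠ v := hTC.symm.ne_of_ncard_eq two_ne_zero hv hy
      have hAC := h.mono_right hyC
      rw [← Set.union_assoc]
      refine ih (hA.join hC hAC hx) (h.union_left hyC hTC.symm) ?_ hu
      rwa [Set.union_comm, hAC.symm.neighborSet_inter_union hTC.right_mem hyv.symm]

end

theorem stmt12 {V : Type} (G : SimpleGraph V) (T₁ T₂ : Set V)
    (hdisj : Disjoint T₁ T₂)
    (h₁ : IsCircleTree G T₁) (h₂ : IsCircleTree G T₂)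
    (x y : V) (hx : x ∈ T₁) (hy : y ∈ T₂)
    (hdx : (G.neighborSet x ∩ T₁).ncard = 2) (hdy : (G.neighborSet y ∩ T₂).ncard = 2)
    (hadj : G.Adj x y)
    (honly : ∀ a ∈ T₁, ∀ b ∈ T₂, G.Adj a b → a = x ∧ b = y) :
    IsCircleTree G (T₁ ∪ T₂) := by
  exact (h₁.builtFromCircles.union h₂.builtFromCircles ⟨hdisj, hx, hy, hadj, honly⟩
    hdx hdy).isCircleTree
end

section
/- Let G be a simple graph and let v₀ and v₁ be distinct P-vertices of G. Let C₀ and C₁ be circles in G such that, for i ∈ {0,1}, v_i ∈ C_i and v_i is the unique vertex of C_i having degree 3 in G (all other vertices of C_i have degree 2 in G). Then C₀ and C₁ are disjoint. -/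
/-- If every vertex of `C` that lies in a circle `D` has degree two, then a connected set `C`
meeting `D` is contained in `D`. -/
theorem IsCircleIn.subset_of_inter_nonempty {V : Type*} {G : SimpleGraph V} {C D : Set V}
    (hD : IsCircleIn G D) (hC : (G.induce C).Connected) (hCD : (C ∩ D).Nonempty)
    (hdeg : ∀ y ∈ C ∩ D, (G.neighborSet y).ncard = 2) : C ⊆ D := by
  obtain ⟨x, hxC, hxD⟩ := hCD
  have walk_mem : ∀ {a b : C}, (G.induce C).Walk a b → (a : V) ∈ D → (b : V) ∈ D := by
    intro a b p
    induction p with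
    | nil => exact id
    | @cons a b c hab _ ih =>
      intro ha
      have hcard := hdeg a ⟨a.2, ha⟩
      have hfin : (G.neighborSet (a : V)).Finite := Set.finite_of_ncard_ne_zero (by omega)
      have heq : G.neighborSet (a : V) ∩ D = G.neighborSet (a : V) :=
        Set.eq_of_subset_of_ncard_le Set.inter_subset_left
          (by rw [hcard, hD.2.2 a ha]) hfin
      exact ih (Set.inter_eq_left.mp heq hab)
  intro y hy
  obtain ⟨p⟩ := hC.preconnected ⟨x, hxC⟩ ⟨y, hy⟩
  exact walk_mem p hxD

theorem stmt14 {V : Type} (G : SimpleGraph V) (v₀ v₁ : V) (hne : v₀ ≠ v₁)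
    (C₀ C₁ : Set V) (h₀ : IsCircleIn G C₀) (h₁ : IsCircleIn G C₁)
    (hv₀ : v₀ ∈ C₀) (hv₁ : v₁ ∈ C₁)
    (hd₀ : (G.neighborSet v₀).ncard = 3) (hd₁ : (G.neighborSet v₁).ncard = 3)
    (hrest₀ : ∀ u ∈ C₀, u ≠ v₀ → (G.neighborSet u).ncard = 2)
    (hrest₁ : ∀ u ∈ C₁, u ≠ v₁ → (G.neighborSet u).ncard = 2) :
    Disjoint C₀ C₁ := by
  have hv₁C₀ : v₁ ∉ C₀ := fun h => by
    have := hrest₀ v₁ h hne.symm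
    omega
  have hv₀C₁ : v₀ ∉ C₁ := fun h => by
    have := hrest₁ v₀ h hne
    omega
  by_contra hdisj
  exact hv₀C₁ (h₁.subset_of_inter_nonempty h₀.2.1 (Set.not_disjoint_iff_nonempty_inter.mp hdisj)
    (fun y hy => hrest₁ y hy.2 (fun h => hv₁C₀ (h ▸ hy.1))) hv₀)
end

section
/- Let G be a simple graph, let T be a set of vertices of G whose induced subgraph is a circle-tree, and let P = (v(0),…,v(n−1)) be a germ in G. If (P ∩ T) ∖ {v(n−1)} is nonempty, then every vertex of P belongs to T. -/
/-- `(v 0, …, v (n-1))` is a germ in `G`: pairwise distinct vertices, `n ≥ 3`, consecutive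
vertices adjacent, all vertices but the last of degree at most `2` in `G`, and the last
vertex of degree `3` in `G`. -/
def IsGerm {V : Type*} (G : SimpleGraph V) (n : ℕ) (v : ℕ → V) : Prop :=
  3 ≤ n ∧
  (∀ i j, i < n → j < n → i ≠ j → v i ≠ v j) ∧
  (∀ i, i + 1 < n → G.Adj (v i) (v (i + 1))) ∧
  (∀ i, i < n - 1 → (G.neighborSet (v i)).Finite ∧ (G.neighborSet (v i)).ncard ≤ 2) ∧
  (G.neighborSet (v (n - 1))).ncard = 3

/-- If a vertex of a circle in `G` has degree at most `2` in `G`, then all its neighbors lie on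
the circle. -/
theorem IsCircleIn.neighborSet_subset {V : Type*} {G : SimpleGraph V} {C : Set V}
    (hC : IsCircleIn G C) {x : V} (hx : x ∈ C) (hfin : (G.neighborSet x).Finite)
    (hdeg : (G.neighborSet x).ncard ≤ 2) : G.neighborSet x ⊆ C := by
  have h : G.neighborSet x ∩ C = G.neighborSet x :=
    Set.eq_of_subset_of_ncard_le Set.inter_subset_left (by rw [hC.2.2 x hx]; exact hdeg) hfin
  exact Set.inter_eq_left.mp h

/-- A circle-tree contains all neighbors of each of its vertices that has degree at most `2`
in `G`. -/
theorem IsCircleTree.neighborSet_subset {V : Type*} {G : SimpleGraph V} {T : Set V}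
    (hT : IsCircleTree G T) {x : V} (hx : x ∈ T) (hfin : (G.neighborSet x).Finite)
    (hdeg : (G.neighborSet x).ncard ≤ 2) : G.neighborSet x ⊆ T := by
  obtain ⟨k, C, -, hC, -, rfl, -⟩ := hT
  obtain ⟨j, hj, hxj⟩ := Set.mem_iUnion₂.mp hx
  exact ((hC j hj).neighborSet_subset hxj hfin hdeg).trans (Set.subset_biUnion_of_mem hj)

theorem stmt16 {V : Type} (G : SimpleGraph V) (T : Set V) (hT : IsCircleTree G T)
    (n : ℕ) (v : ℕ → V) (hgerm : IsGerm G n v)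
    (hmeet : ∃ i, i < n - 1 ∧ v i ∈ T) :
    ∀ i, i < n → v i ∈ T := by
  obtain ⟨-, -, hadj, hdeg, -⟩ := hgerm
  obtain ⟨i, hi, hiT⟩ := hmeet
  have step : ∀ j, j < n - 1 → v j ∈ T → G.neighborSet (v j) ⊆ T := fun j hj hjT =>
    hT.neighborSet_subset hjT (hdeg j hj).1 (hdeg j hj).2
  intro m hm
  rcases le_total i m with him | hmi
  · induction m, him using Nat.le_induction with
    | base => exact hiT
    | succ m _ ih => exact step m (by omega) (ih (by omega)) (hadj m hm)
  · induction hmi using Nat.decreasingInduction with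
    | self => exact hiT
    | of_succ m hmi ih =>
      exact step (m + 1) (by omega) (ih (by omega)) (hadj m (by omega)).symm
end

section
/- Let G = (V,E) be a countable 3-regular simple graph which contains no clique on 4 vertices. Then there exists an independent set W ⊆ V such that every connected component of the subgraph of G induced by V ∖ W is finite and is either a single vertex or a path graph; in particular, the induced subgraph on V ∖ W has maximum degree at most 2 and contains no circle. -/
/-- The induced subgraph of `G` on `A` is a path graph: finite, connected, of maximum
degree at most `2`, with exactly two vertices of degree `1`. -/
def IsPathGraphOn {V : Type*} (G : SimpleGraph V) (A : Set V) : Prop :=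
  A.Finite ∧ (G.induce A).Connected ∧
  (∀ x ∈ A, (G.neighborSet x ∩ A).ncard ≤ 2) ∧
  {x ∈ A | (G.neighborSet x ∩ A).ncard = 1}.ncard = 2

namespace CubicGraph

/-- Every vertex has exactly three neighbours. -/
def IsCubic {V : Type*} (G : SimpleGraph V) : Prop :=
  ∀ v, ∃ a b c, a ≠ b ∧ a ≠ c ∧ b ≠ c ∧ ∀ u, G.Adj v u ↔ u = a ∨ u = b ∨ u = c

/-- Every nonempty subset of `F` has a vertex with at most one neighbour in that subset;
equivalently, `F` induces a forest. -/
def IsForestOn {V : Type*} (G : SimpleGraph V) (F : Finset V) : Prop :=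
  ∀ Y ⊆ F, Y.Nonempty → ∃ y ∈ Y, ∀ a ∈ Y, ∀ b ∈ Y, G.Adj y a → G.Adj y b → a = b

/-- A partial solution on the finite set `S`: the independent set `W ⊆ S` dominates `S \ W`,
which induces a forest. -/
structure Good {V : Type*} [DecidableEq V] (G : SimpleGraph V) (S W : Finset V) : Prop where
  subset : W ⊆ S
  indep : ∀ x ∈ W, ∀ y ∈ W, ¬ G.Adj x y
  dom : ∀ f ∈ S, f ∉ W → ∃ w ∈ W, G.Adj f w
  forest : IsForestOn G (S \ W)

/-- The partial solution `(S, W)` extends to the larger set `T`, with new independent set `X`. -/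
structure Extends {V : Type*} [DecidableEq V] (G : SimpleGraph V) (S W T X : Finset V) :
    Prop where
  good : Good G T X
  subset : S ⊆ T
  agree : ∀ s ∈ S, (s ∈ X ↔ s ∈ W)

theorem IsCubic.not_four {V : Type*} {G : SimpleGraph V} (hG : IsCubic G) {v a b c d : V}
    (ha : G.Adj v a) (hb : G.Adj v b)
    (hc : G.Adj v c) (hd : G.Adj v d) (h1 : a ≠ b) (h2 : a ≠ c) (h3 : a ≠ d) (h4 : b ≠ c)
    (h5 : b ≠ d) (h6 : c ≠ d) : False := by
  obtain ⟨x, y, z, -, -, -, h⟩ := hG v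
  rw [h] at ha hb hc hd
  grind

theorem IsCubic.eq_of_adj {V : Type*} {G : SimpleGraph V} (hG : IsCubic G) {v a b c d : V}
    (ha : G.Adj v a) (hb : G.Adj v b)
    (hc : G.Adj v c) (h1 : a ≠ b) (h2 : a ≠ c) (h4 : b ≠ c) (hd : G.Adj v d) :
    d = a ∨ d = b ∨ d = c := by
  by_contra! h
  exact hG.not_four ha hb hc hd h1 h2 h.1.symm h4 h.2.1.symm h.2.2.symm

section

variable {V : Type*} [DecidableEq V] {G : SimpleGraph V} {S W T X R Y : Finset V} {v : V}

theorem Good.extends_self (h : Good G S W) : Extends G S W S W :=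
  ⟨h, subset_rfl, fun _ _ => Iff.rfl⟩

theorem Extends.trans (h : Extends G S W T X) (h' : Extends G T X R Y) : Extends G S W R Y :=
  ⟨h'.good, h.subset.trans h'.subset, fun s hs => (h'.agree s (h.subset hs)).trans (h.agree s hs)⟩

theorem Good.insert_indep (h : Good G S W) (hv : v ∉ S) (hw : ∀ w ∈ W, ¬ G.Adj v w) :
    Extends G S W (insert v S) (insert v W) := by
  refine ⟨⟨Finset.insert_subset_insert _ h.subset, ?_, ?_, ?_⟩, Finset.subset_insert _ _, ?_⟩
  · intro x hx y hy hxy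
    rw [Finset.mem_insert] at hx hy
    rcases hx with rfl | hx <;> rcases hy with rfl | hy
    · exact G.loopless.irrefl _ hxy
    · exact hw _ hy hxy
    · exact hw _ hx hxy.symm
    · exact h.indep _ hx _ hy hxy
  · intro f hf hfW
    obtain ⟨w, hw, hfw⟩ := h.dom f (by grind) (by grind)
    exact ⟨w, by grind, hfw⟩
  · have : insert v S \ insert v W = S \ W := by grind
    rw [this]
    exact h.forest
  · grind

theorem Good.insert_forest (h : Good G S W) (hv : v ∉ S) {w : V} (hw : w ∈ W) (hvw : G.Adj v w)
    (hu : ∀ a ∈ S, a ∉ W → ∀ b ∈ S, b ∉ W → G.Adj v a → G.Adj v b → a = b) :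
    Extends G S W (insert v S) W := by
  refine ⟨⟨h.subset.trans (Finset.subset_insert _ _), h.indep, ?_, ?_⟩,
    Finset.subset_insert _ _, fun _ _ => Iff.rfl⟩
  · intro f hf hfW
    rcases Finset.mem_insert.1 hf with rfl | hf
    · exact ⟨w, hw, hvw⟩
    · exact h.dom f hf hfW
  · intro Y hY hne
    by_cases hvY : v ∈ Y
    · refine ⟨v, hvY, fun a ha b hb hva hvb => ?_⟩
      have := hva.ne
      have := hvb.ne
      have := hY ha
      have := hY hb
      exact hu a (by grind) (by grind) b (by grind) (by grind) hva hvb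
    · exact h.forest Y (fun y hy => by have := hY hy; grind) hne

/-- A vertex with an uncoloured neighbour can always be coloured. -/
theorem Good.insert_of_exit (hG : IsCubic G) (h : Good G S W) (hv : v ∉ S) {u : V}
    (huS : u ∉ S) (huv : G.Adj v u) : ∃ X, Extends G S W (insert v S) X := by
  by_cases hw : ∃ w ∈ W, G.Adj v w
  · obtain ⟨w, hw, hvw⟩ := hw
    refine ⟨W, h.insert_forest hv hw hvw fun a ha haW b hb hbW hva hvb => ?_⟩
    by_contra hab
    have := h.subset hw
    exact hG.not_four huv hvw hva hvb (by grind) (by grind) (by grind) (by grind) (by grind) hab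
  · push Not at hw
    exact ⟨_, h.insert_indep hv hw⟩

/-- A vertex with two neighbours in the independent set can be coloured. -/
theorem Good.insert_of_two (hG : IsCubic G) (h : Good G S W) (hv : v ∉ S) {x y : V}
    (hx : x ∈ W) (hy : y ∈ W) (hxy : x ≠ y) (hvx : G.Adj v x) (hvy : G.Adj v y) :
    ∃ X, Extends G S W (insert v S) X := by
  refine ⟨W, h.insert_forest hv hx hvx fun a ha haW b hb hbW hva hvb => ?_⟩
  by_contra hab
  exact hG.not_four hvx hvy hva hvb hxy (by grind) (by grind) (by grind) (by grind) hab

/-- Greedy colouring of `Z`, possible if every nonempty part of `Z` has a way out. -/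
theorem Good.greedy (hG : IsCubic G) (h : Good G S W) (Z : Finset V)
    (hZ : ∀ Y ⊆ Z, Y.Nonempty → ∃ y ∈ Y, ∃ u, u ∉ S ∧ u ∉ Y ∧ G.Adj y u) :
    ∃ X, Extends G S W (S ∪ Z) X := by
  induction Z using Finset.strongInduction with
  | H Z ih =>
    rcases Z.eq_empty_or_nonempty with rfl | hne
    · exact ⟨W, by simpa using h.extends_self⟩
    · obtain ⟨y, hy, u, huS, huZ, hyu⟩ := hZ Z subset_rfl hne
      obtain ⟨X, hX⟩ := ih (Z.erase y) (Finset.erase_ssubset hy)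
        fun Y hY => hZ Y (hY.trans (Finset.erase_subset _ _))
      by_cases hyS : y ∈ S
      · have : S ∪ Z.erase y = S ∪ Z := by grind
        rw [this] at hX
        exact ⟨X, hX⟩
      · obtain ⟨X', hX'⟩ := hX.good.insert_of_exit hG (v := y) (by grind) (u := u) (by grind) hyu
        have : insert y (S ∪ Z.erase y) = S ∪ Z := by grind
        rw [this] at hX'
        exact ⟨X', hX.trans hX'⟩

end

theorem exists_exit_up {V : Type*} {f : ℕ → V} {Y : Finset V} {i r : ℕ} (hi : f i ∈ Y)
    (hr : f r ∉ Y) (hir : i ≤ r) : ∃ j, i ≤ j ∧ j < r ∧ f j ∈ Y ∧ f (j + 1) ∉ Y := by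
  induction r, hir using Nat.le_induction with
  | base => exact absurd hi hr
  | succ r hir ih =>
    by_cases h : f r ∈ Y
    · exact ⟨r, hir, Nat.lt_succ_self r, h, hr⟩
    · obtain ⟨j, h1, h2, h3⟩ := ih h
      exact ⟨j, h1, by omega, h3⟩

theorem exists_exit_down {V : Type*} {f : ℕ → V} {Y : Finset V} {i l : ℕ} (hi : f i ∈ Y)
    (hl : f l ∉ Y) (hli : l ≤ i) : ∃ j, l ≤ j ∧ j < i ∧ f j ∉ Y ∧ f (j + 1) ∈ Y := by
  induction i, hli using Nat.le_induction with
  | base => exact absurd hi hl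
  | succ r hir ih =>
    by_cases h : f r ∈ Y
    · obtain ⟨j, h1, h2, h3⟩ := ih h
      exact ⟨j, h1, by omega, h3⟩
    · exact ⟨r, hir, Nat.lt_succ_self r, h, hi⟩

/-- The vertices `f 0, …, f k` form a cycle, and `f 0` has a chord to `f s` whereas its two
neighbours on the cycle are not adjacent. -/
structure ChordedCycle {V : Type*} (G : SimpleGraph V) (f : ℕ → V) (k s : ℕ) : Prop where
  inj : ∀ i ≤ k, ∀ j ≤ k, f i = f j → i = j
  adj : ∀ i < k, G.Adj (f i) (f (i + 1))
  close : G.Adj (f 0) (f k)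
  one_lt : 1 < s
  lt : s < k
  chord : G.Adj (f 0) (f s)
  not_adj : ¬ G.Adj (f 1) (f k)

section

variable {V : Type*} {G : SimpleGraph V} {f : ℕ → V} {k s : ℕ}

theorem ChordedCycle.eq_of_adj (hG : IsCubic G) (h : ChordedCycle G f k s) {u : V}
    (hu : G.Adj (f 0) u) : u = f 1 ∨ u = f s ∨ u = f k := by
  have h1 := h.one_lt
  have h2 := h.lt
  refine hG.eq_of_adj (h.adj 0 (by omega)) h.chord h.close ?_ ?_ ?_ hu <;> intro e
  · have := h.inj _ (by omega) _ (by omega) e; omega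
  · have := h.inj _ (by omega) _ (by omega) e; omega
  · have := h.inj _ (by omega) _ (by omega) e; omega

theorem ChordedCycle.reverse (h : ChordedCycle G f k s) :
    ChordedCycle G (fun i => if i = 0 then f 0 else f (k + 1 - i)) k (k + 1 - s) := by
  have h1 := h.one_lt
  have h2 := h.lt
  refine ⟨?_, ?_, ?_, by omega, by omega, ?_, ?_⟩
  · intro i hi j hj e
    split_ifs at e with hi0 hj0 hj0
    · omega
    · have := h.inj _ (by omega) _ (by omega) e; omega
    · have := h.inj _ (by omega) _ (by omega) e; omega
    · have := h.inj _ (by omega) _ (by omega) e; omega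
  · intro i hi
    rcases i with _ | i
    · simpa using h.close
    · have := (h.adj (k + 1 - (i + 1 + 1)) (by omega)).symm
      rw [show k + 1 - (i + 1 + 1) + 1 = k + 1 - (i + 1) by omega] at this
      simpa using this
  · have := h.adj 0 (by omega)
    simp only [if_true, if_neg (show k ≠ 0 by omega)]
    simpa using this
  · simp only [if_true, if_neg (show k + 1 - s ≠ 0 by omega)]
    rw [show k + 1 - (k + 1 - s) = s by omega]
    exact h.chord
  · simp only [one_ne_zero, if_false, if_neg (show k ≠ 0 by omega)]
    rw [show k + 1 - k = 1 by omega]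
    exact fun e => h.not_adj e.symm

variable [DecidableEq V] {S W : Finset V}

theorem Good.extend_cycle_aux (hG : IsCubic G) (h : Good G S W) (hf : ChordedCycle G f k s)
    (hS : ∀ i ≤ k, f i ∉ S) {x : V} (hx : x ∈ W) (hkx : G.Adj (f k) x) :
    ∃ X, Extends G S W (S ∪ (Finset.range (k + 1)).image f) X := by
  have h1 := hf.one_lt
  have h2 := hf.lt
  have e1 := h.insert_indep (hS 0 (by omega)) (v := f 0) fun w hw e => by
    have := h.subset hw
    rcases hf.eq_of_adj hG e with rfl | rfl | rfl
    · exact hS 1 (by omega) this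
    · exact hS s (by omega) this
    · exact hS k le_rfl this
  obtain ⟨X, e2⟩ := e1.good.greedy hG ((Finset.Ico 1 k).image f) (by
    intro Y hY ⟨y, hy⟩
    obtain ⟨i, hi, rfl⟩ := Finset.mem_image.1 (hY hy)
    rw [Finset.mem_Ico] at hi
    have hk : f k ∉ Y := fun hk => by
      obtain ⟨j, hj, e⟩ := Finset.mem_image.1 (hY hk)
      rw [Finset.mem_Ico] at hj
      have := hf.inj _ (by omega) _ (by omega) e
      omega
    obtain ⟨j, hij, hjk, hj, hj'⟩ := exists_exit_up hy hk (by omega)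
    refine ⟨_, hj, _, ?_, hj', hf.adj j hjk⟩
    rw [Finset.mem_insert, not_or]
    refine ⟨fun e => ?_, hS _ (by omega)⟩
    have := hf.inj _ (by omega) _ (by omega) e
    omega)
  have hkT : f k ∉ insert (f 0) S ∪ (Finset.Ico 1 k).image f := by
    simp only [Finset.mem_union, Finset.mem_insert, Finset.mem_image, Finset.mem_Ico, not_or,
      not_exists, not_and]
    refine ⟨⟨fun e => ?_, hS k le_rfl⟩, fun j hj e => ?_⟩
    · have := hf.inj _ (by omega) _ (by omega) e
      omega
    · have := hf.inj _ (by omega) _ (by omega) e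
      omega
  have hxS := h.subset hx
  obtain ⟨X', e3⟩ := e2.good.insert_of_two hG hkT (x := f 0) (y := x)
    ((e2.agree _ (Finset.mem_insert_self _ _)).2 (Finset.mem_insert_self _ _))
    ((e2.agree _ (Finset.mem_insert_of_mem hxS)).2 (Finset.mem_insert_of_mem hx))
    (fun e => hS 0 (by omega) (e ▸ hxS)) hf.close.symm hkx
  have : insert (f k) (insert (f 0) S ∪ (Finset.Ico 1 k).image f)
      = S ∪ (Finset.range (k + 1)).image f := by
    ext y
    simp only [Finset.mem_union, Finset.mem_insert, Finset.mem_image, Finset.mem_Ico,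
      Finset.mem_range]
    constructor
    · rintro (rfl | (rfl | hy) | ⟨j, hj, rfl⟩)
      · exact Or.inr ⟨k, by omega, rfl⟩
      · exact Or.inr ⟨0, by omega, rfl⟩
      · exact Or.inl hy
      · exact Or.inr ⟨j, by omega, rfl⟩
    · rintro (hy | ⟨j, hj, rfl⟩)
      · exact Or.inr (Or.inl (Or.inr hy))
      · rcases Nat.eq_zero_or_pos j with rfl | hj0
        · exact Or.inr (Or.inl (Or.inl rfl))
        · rcases (Nat.lt_succ_iff.1 hj).eq_or_lt with rfl | hjk
          · exact Or.inl rfl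
          · exact Or.inr (Or.inr ⟨j, ⟨hj0, hjk⟩, rfl⟩)
  rw [this] at e3
  exact ⟨X', (e1.trans e2).trans e3⟩

/-- Any partial solution outside a chorded cycle extends to the cycle. -/
theorem Good.extend_cycle (hG : IsCubic G) (h : Good G S W) (hf : ChordedCycle G f k s)
    (hS : ∀ i ≤ k, f i ∉ S) : ∃ X, Extends G S W (S ∪ (Finset.range (k + 1)).image f) X := by
  have h1 := hf.one_lt
  have h2 := hf.lt
  by_cases hk : ∃ x ∈ W, G.Adj (f k) x
  · obtain ⟨x, hx, hkx⟩ := hk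
    exact h.extend_cycle_aux hG hf hS hx hkx
  by_cases h1x : ∃ x ∈ W, G.Adj (f 1) x
  · obtain ⟨x, hx, h1x⟩ := h1x
    have := h.extend_cycle_aux hG hf.reverse (fun i hi => by
      split_ifs
      · exact hS _ (by omega)
      · exact hS _ (by omega)) hx (by
      simp only [if_neg (show k ≠ 0 by omega)]
      rw [show k + 1 - k = 1 by omega]
      exact h1x)
    convert this using 4
    ext y
    simp only [Finset.mem_image, Finset.mem_range]
    constructor
    · rintro ⟨j, hj, rfl⟩
      rcases Nat.eq_zero_or_pos j with rfl | hj0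
      · exact ⟨0, by omega, by simp⟩
      · refine ⟨k + 1 - j, by omega, ?_⟩
        rw [if_neg (by omega)]
        congr 1
        omega
    · rintro ⟨j, hj, rfl⟩
      split_ifs
      · exact ⟨0, by omega, rfl⟩
      · exact ⟨k + 1 - j, by omega, rfl⟩
  push Not at hk h1x
  have e1 := h.insert_indep (hS 1 (by omega)) h1x
  have hk1 : f k ≠ f 1 := fun e => by
    have := hf.inj _ (by omega) _ (by omega) e
    omega
  have e2 := e1.good.insert_indep (v := f k) (by simp [hk1, hS k le_rfl]) (by
    intro w hw e
    rcases Finset.mem_insert.1 hw with rfl | hw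
    · exact hf.not_adj e.symm
    · exact hk _ hw e)
  obtain ⟨X, e3⟩ := e2.good.greedy hG ((Finset.Ico 2 k).image f) (by
    have hmem : ∀ j < k, j ≠ 1 → f j ∉ insert (f k) (insert (f 1) S) := by
      intro j hj hj1
      simp only [Finset.mem_insert, not_or]
      refine ⟨fun e => ?_, fun e => ?_, hS _ (by omega)⟩
      · have := hf.inj _ (by omega) _ (by omega) e
        omega
      · have := hf.inj _ (by omega) _ (by omega) e
        omega
    intro Y hY ⟨y, hy⟩
    obtain ⟨i, hi, rfl⟩ := Finset.mem_image.1 (hY hy)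
    rw [Finset.mem_Ico] at hi
    have h0 : f 0 ∉ Y := fun hk => by
      obtain ⟨j, hj, e⟩ := Finset.mem_image.1 (hY hk)
      rw [Finset.mem_Ico] at hj
      have := hf.inj _ (by omega) _ (by omega) e
      omega
    by_cases hs : f s ∈ Y
    · exact ⟨_, hs, f 0, hmem 0 (by omega) (by omega), h0, hf.chord.symm⟩
    rcases le_total i s with his | his
    · obtain ⟨j, hij, hjk, hj, hj'⟩ := exists_exit_up hy hs his
      exact ⟨_, hj, _, hmem _ (by omega) (by omega), hj', hf.adj j (by omega)⟩
    · obtain ⟨j, hij, hjk, hj, hj'⟩ := exists_exit_down hy hs his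
      exact ⟨_, hj', _, hmem _ (by omega) (by omega), hj, (hf.adj j (by omega)).symm⟩)
  have h0T : f 0 ∉ insert (f k) (insert (f 1) S) ∪ (Finset.Ico 2 k).image f := by
    simp only [Finset.mem_union, Finset.mem_insert, Finset.mem_image, Finset.mem_Ico, not_or,
      not_exists, not_and]
    refine ⟨⟨fun e => ?_, fun e => ?_, hS 0 (by omega)⟩, fun j hj e => ?_⟩
    · have := hf.inj _ (by omega) _ (by omega) e
      omega
    · have := hf.inj _ (by omega) _ (by omega) e
      omega
    · have := hf.inj _ (by omega) _ (by omega) e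
      omega
  obtain ⟨X', e4⟩ := e3.good.insert_of_two hG h0T (x := f k) (y := f 1)
    ((e3.agree _ (by simp)).2 (by simp)) ((e3.agree _ (by simp)).2 (by simp)) hk1 hf.close
    (hf.adj 0 (by omega))
  have : insert (f 0) (insert (f k) (insert (f 1) S) ∪ (Finset.Ico 2 k).image f)
      = S ∪ (Finset.range (k + 1)).image f := by
    ext y
    simp only [Finset.mem_union, Finset.mem_insert, Finset.mem_image, Finset.mem_Ico,
      Finset.mem_range]
    constructor
    · rintro (rfl | (rfl | rfl | hy) | ⟨j, hj, rfl⟩)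
      · exact Or.inr ⟨0, by omega, rfl⟩
      · exact Or.inr ⟨k, by omega, rfl⟩
      · exact Or.inr ⟨1, by omega, rfl⟩
      · exact Or.inl hy
      · exact Or.inr ⟨j, by omega, rfl⟩
    · rintro (hy | ⟨j, hj, rfl⟩)
      · exact Or.inr (Or.inl (Or.inr (Or.inr hy)))
      · rcases Nat.eq_zero_or_pos j with rfl | hj0
        · exact Or.inl rfl
        · rcases (Nat.lt_succ_iff.1 hj).eq_or_lt with rfl | hjk
          · exact Or.inr (Or.inl (Or.inl rfl))
          · rcases (Nat.succ_le_of_lt hj0).eq_or_lt with rfl | hj1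
            · exact Or.inr (Or.inl (Or.inr (Or.inl rfl)))
            · exact Or.inr (Or.inr ⟨j, ⟨hj1, hjk⟩, rfl⟩)
  rw [this] at e4
  exact ⟨X', ((e1.trans e2).trans e3).trans e4⟩

end

theorem exists_longest_path {V : Type*} (G : SimpleGraph V) {Z : Finset V} {z : V} (hz : z ∈ Z) :
    ∃ (n : ℕ) (p : ℕ → V), (∀ i ≤ n, ∀ j ≤ n, p i = p j → i = j) ∧ (∀ i ≤ n, p i ∈ Z) ∧
      (∀ i < n, G.Adj (p i) (p (i + 1))) ∧ p n = z ∧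
      ∀ u ∈ Z, G.Adj (p 0) u → ∃ i ≤ n, u = p i := by
  classical
  let P : ℕ → Prop := fun n => ∃ p : ℕ → V, (∀ i ≤ n, ∀ j ≤ n, p i = p j → i = j) ∧
    (∀ i ≤ n, p i ∈ Z) ∧ (∀ i < n, G.Adj (p i) (p (i + 1))) ∧ p n = z
  have hP0 : P 0 := ⟨fun _ => z, by simp, by simp [hz], by simp, rfl⟩
  have hPle : ∀ n, P n → n ≤ Z.card := by
    rintro n ⟨p, hinj, hmem, -⟩
    have := Finset.card_le_card_of_injOn (s := Finset.range (n + 1)) (t := Z) p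
      (fun i hi => hmem i (by simpa [Nat.lt_succ_iff] using hi))
      (fun i hi j hj e => hinj i (by simpa [Nat.lt_succ_iff] using hi) j
        (by simpa [Nat.lt_succ_iff] using hj) e)
    rw [Finset.card_range] at this
    omega
  obtain ⟨p, hinj, hmem, hadj, hn⟩ := Nat.findGreatest_spec (P := P) (Nat.zero_le Z.card) hP0
  have hmax : ∀ m, P m → m ≤ Nat.findGreatest P Z.card := fun m hm =>
    Nat.le_findGreatest (hPle m hm) hm
  generalize Nat.findGreatest P Z.card = n at hinj hmem hadj hn hmax
  refine ⟨n, p, hinj, hmem, hadj, hn, fun u hu hpu => ?_⟩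
  by_contra! hnot
  have := hmax (n + 1) ⟨fun i => if i = 0 then u else p (i - 1), ?_, ?_, ?_, by simpa using hn⟩
  · omega
  · intro i hi j hj e
    dsimp only at e
    split_ifs at e with h1 h2 h2
    · omega
    · exact absurd e (hnot _ (by omega))
    · exact absurd e.symm (hnot _ (by omega))
    · have := hinj _ (by omega) _ (by omega) e
      omega
  · intro i hi
    dsimp only
    split_ifs
    · exact hu
    · exact hmem _ (by omega)
  · intro i hi
    rcases i with _ | i
    · simpa using hpu.symm
    · simpa using hadj i (by omega)

theorem exists_chordedCycle {V : Type*} {G : SimpleGraph V} (hG : IsCubic G)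
    (hK : ∀ a b c d, G.Adj a b → G.Adj a c → G.Adj a d → G.Adj b c → G.Adj b d → ¬ G.Adj c d)
    {n : ℕ} {p : ℕ → V} (hinj : ∀ i ≤ n, ∀ j ≤ n, p i = p j → i = j)
    (hadj : ∀ i < n, G.Adj (p i) (p (i + 1))) (hmax : ∀ u, G.Adj (p 0) u → ∃ i ≤ n, u = p i) :
    ∃ f k s, ChordedCycle G f k s ∧ ∀ i ≤ k, ∃ j ≤ n, f i = p j := by
  have key : ∃ i j, 1 < i ∧ i < j ∧ j ≤ n ∧ G.Adj (p 0) (p i) ∧ G.Adj (p 0) (p j) := by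
    obtain ⟨a, b, c, hab, hac, hbc, h⟩ := hG (p 0)
    have ha := (h a).2 (by simp)
    have hb := (h b).2 (by simp)
    have hc := (h c).2 (by simp)
    obtain ⟨i, hi, rfl⟩ := hmax a ha
    obtain ⟨j, hj, rfl⟩ := hmax b hb
    obtain ⟨k, hk, rfl⟩ := hmax c hc
    have hij : i ≠ j := fun e => hab (e ▸ rfl)
    have hik : i ≠ k := fun e => hac (e ▸ rfl)
    have hjk : j ≠ k := fun e => hbc (e ▸ rfl)
    have hi0 : i ≠ 0 := fun e => ha.ne (e ▸ rfl)
    have hj0 : j ≠ 0 := fun e => hb.ne (e ▸ rfl)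
    have hk0 : k ≠ 0 := fun e => hc.ne (e ▸ rfl)
    rcases lt_or_gt_of_ne hij with h1 | h1 <;> rcases lt_or_gt_of_ne hik with h2 | h2 <;>
      rcases lt_or_gt_of_ne hjk with h3 | h3
    · exact ⟨j, k, by omega, h3, hk, hb, hc⟩
    · exact ⟨k, j, by omega, h3, hj, hc, hb⟩
    · omega
    · exact ⟨i, j, by omega, h1, hj, ha, hb⟩
    · exact ⟨i, k, by omega, h2, hk, ha, hc⟩
    · omega
    · exact ⟨k, i, by omega, h2, hi, hc, ha⟩
    · exact ⟨j, i, by omega, h1, hi, hb, ha⟩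
  obtain ⟨i, j, h1i, hij, hjn, hi, hj⟩ := key
  have h01 := hadj 0 (by omega)
  rw [zero_add] at h01
  by_cases h1j : G.Adj (p 1) (p j)
  swap
  · exact ⟨p, j, i, ⟨fun a ha b hb => hinj a (by omega) b (by omega),
      fun a ha => hadj a (by omega), hj, h1i, hij, hi, h1j⟩, fun a ha => ⟨a, by omega, rfl⟩⟩
  by_cases h02 : G.Adj (p 0) (p 2)
  swap
  · refine ⟨fun a => if a = j then p 0 else p (a + 1), j, j - 1, ⟨?_, ?_, ?_, by omega, by omega,
      ?_, ?_⟩, ?_⟩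
    · intro a ha b hb e
      split_ifs at e
      · omega
      · have := hinj _ (by omega) _ (by omega) e
        omega
      · have := hinj _ (by omega) _ (by omega) e
        omega
      · have := hinj _ (by omega) _ (by omega) e
        omega
    · intro a ha
      rw [if_neg (by omega)]
      split_ifs with h
      · rw [h]
        exact hj.symm
      · exact hadj _ (by omega)
    · simpa [show 0 ≠ j by omega] using h01.symm
    · simpa [show 0 ≠ j by omega, show j - 1 ≠ j by omega, show j - 1 + 1 = j by omega] using h1j
    · simpa [show 1 ≠ j by omega] using fun e => h02 e.symm
    · intro a ha
      dsimp only
      split_ifs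
      · exact ⟨0, by omega, rfl⟩
      · exact ⟨a + 1, by omega, rfl⟩
  have h12 := hadj 1 (by omega)
  have h2j : 2 < j := by omega
  have hnot : ¬ G.Adj (p 2) (p j) := hK _ _ _ _ h01 h02 hj h12 h1j
  have h3j : j ≠ 3 := by
    rintro rfl
    exact hnot (hadj 2 (by omega))
  have hlast : ¬ G.Adj (p 0) (p (j - 1)) := fun e => by
    have hne : ∀ a ≤ n, ∀ b ≤ n, a ≠ b → p a ≠ p b := fun a ha b hb h e => h (hinj a ha b hb e)
    rcases hG.eq_of_adj h01 h02 hj (hne _ (by omega) _ (by omega) (by omega))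
      (hne _ (by omega) _ (by omega) (by omega)) (hne _ (by omega) _ (by omega) (by omega)) e
      with e | e | e
    · have := hinj _ (by omega) _ (by omega) e
      omega
    · have := hinj _ (by omega) _ (by omega) e
      omega
    · have := hinj _ (by omega) _ (by omega) e
      omega
  refine ⟨fun a => if a = 0 then p j else p (a - 1), j, 2, ⟨?_, ?_, ?_, by omega, by omega,
      ?_, ?_⟩, ?_⟩
  · intro a ha b hb e
    split_ifs at e
    · omega
    · have := hinj _ (by omega) _ (by omega) e
      omega
    · have := hinj _ (by omega) _ (by omega) e
      omega
    · have := hinj _ (by omega) _ (by omega) e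
      omega
  · intro a ha
    rcases a with _ | a
    · simpa using hj.symm
    · simpa using hadj a (by omega)
  · have := hadj (j - 1) (by omega)
    rw [show j - 1 + 1 = j by omega] at this
    simpa [show j ≠ 0 by omega] using this.symm
  · simpa using h1j.symm
  · simpa [show j ≠ 0 by omega] using hlast
  · intro a ha
    dsimp only
    split_ifs
    · exact ⟨j, by omega, rfl⟩
    · exact ⟨a - 1, by omega, rfl⟩

/-- A partial solution extends to a finite set all of whose outgoing edges but at most one
(namely `y₀ x`) have been coloured. -/
theorem Good.extend_closed {V : Type*} [DecidableEq V] {G : SimpleGraph V} (hG : IsCubic G)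
    (hK : ∀ a b c d, G.Adj a b → G.Adj a c → G.Adj a d → G.Adj b c → G.Adj b d → ¬ G.Adj c d)
    {S W Z : Finset V} (h : Good G S W) (hZS : Disjoint Z S) {y₀ x : V}
    (hZ : ∀ z ∈ Z, ∀ u, G.Adj z u → u ∈ Z ∨ (z = y₀ ∧ u = x)) :
    ∃ X, Extends G S W (S ∪ Z) X := by
  induction Z using Finset.strongInduction generalizing S W with
  | H Z ih =>
    rcases Z.eq_empty_or_nonempty with rfl | hne
    · exact ⟨W, by simpa using h.extends_self⟩
    by_cases hsplit : ∃ Y ⊂ Z, Y.Nonempty ∧ ∀ y ∈ Y, ∀ u ∈ Z, G.Adj y u → u ∈ Y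
    · obtain ⟨Y, hYZ, hY, hYadj⟩ := hsplit
      obtain ⟨X, e1⟩ := ih Y hYZ h (Finset.disjoint_of_subset_left hYZ.1 hZS) (by
        intro z hz u hzu
        rcases hZ z (hYZ.1 hz) u hzu with hu | hu
        · exact Or.inl (hYadj z hz u hu hzu)
        · exact Or.inr hu)
      obtain ⟨X', e2⟩ := ih (Z \ Y) (Finset.sdiff_ssubset hYZ.1 hY) e1.good (by
          rw [Finset.disjoint_left] at hZS ⊢
          grind) (by
        intro z hz u hzu
        rw [Finset.mem_sdiff] at hz
        rcases hZ z hz.1 u hzu with hu | hu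
        · refine Or.inl (Finset.mem_sdiff.2 ⟨hu, fun huY => hz.2 ?_⟩)
          exact hYadj u huY z hz.1 hzu.symm
        · exact Or.inr hu)
      rw [Finset.union_assoc, Finset.union_sdiff_of_subset hYZ.1] at e2
      exact ⟨X', e1.trans e2⟩
    push Not at hsplit
    obtain ⟨z, hz, hzy⟩ : ∃ z ∈ Z, y₀ ∈ Z → z = y₀ := by
      by_cases hy : y₀ ∈ Z
      · exact ⟨y₀, hy, fun _ => rfl⟩
      · exact ⟨hne.choose, hne.choose_spec, fun h => absurd h hy⟩
    obtain ⟨n, p, hinj, hmem, hadj, hpn, hmax⟩ := exists_longest_path G hz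
    have hp0 : p 0 ≠ y₀ := by
      intro e
      have hzy := hzy (e ▸ hmem 0 (Nat.zero_le _))
      have hn : 0 = n := hinj _ (by omega) _ le_rfl (by rw [e, hpn, hzy])
      subst hn
      obtain ⟨a, b, c, hab, hac, hbc, hadj⟩ := hG (p 0)
      have hnot : ∀ u, G.Adj (p 0) u → u = x := by
        intro u hu
        rcases hZ _ (hmem 0 le_rfl) u hu with huZ | ⟨-, hux⟩
        · obtain ⟨i, hi, rfl⟩ := hmax u huZ hu
          obtain rfl : i = 0 := by omega
          exact absurd hu (G.loopless.irrefl _)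
        · exact hux
      exact hab ((hnot a ((hadj a).2 (by simp))).trans (hnot b ((hadj b).2 (by simp))).symm)
    obtain ⟨f, k, s, hf, hfp⟩ := exists_chordedCycle hG hK hinj hadj (fun u hu =>
      hmax u ((hZ _ (hmem 0 (Nat.zero_le _)) u hu).resolve_right fun e => hp0 e.1) hu)
    have hfZ : ∀ i ≤ k, f i ∈ Z := fun i hi => by
      obtain ⟨j, hj, e⟩ := hfp i hi
      exact e ▸ hmem j hj
    rw [Finset.disjoint_left] at hZS
    obtain ⟨X, e1⟩ := h.greedy hG (Z \ (Finset.range (k + 1)).image f) (by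
      intro Y hY hYne
      obtain ⟨y, hy, u, hu, hyu, huY⟩ := hsplit Y ⟨hY.trans Finset.sdiff_subset, fun hle => by
        have h1 := hY (hle (hfZ 0 (Nat.zero_le _)))
        rw [Finset.mem_sdiff, Finset.mem_image] at h1
        exact h1.2 ⟨0, by simp, rfl⟩⟩ hYne
      exact ⟨y, hy, u, hZS hu, huY, hyu⟩)
    obtain ⟨X', e2⟩ := e1.good.extend_cycle hG hf (by
      intro i hi
      simp only [Finset.mem_union, Finset.mem_sdiff, Finset.mem_image, not_or, not_and, not_not]
      exact ⟨hZS (hfZ i hi), fun _ => ⟨i, by simpa [Nat.lt_succ_iff] using hi, rfl⟩⟩)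
    rw [Finset.union_assoc, Finset.sdiff_union_of_subset] at e2
    · exact ⟨X', e1.trans e2⟩
    · intro y hy
      obtain ⟨i, hi, rfl⟩ := Finset.mem_image.1 hy
      exact hfZ i (by simpa [Nat.lt_succ_iff] using hi)

/-- The finite components of the complement of `S` are components of the whole graph. -/
def PocketFree {V : Type*} (G : SimpleGraph V) (S : Finset V) : Prop :=
  ∀ Y : Finset V, Disjoint Y S → (∀ y ∈ Y, ∀ u, G.Adj y u → u ∈ Y ∨ u ∈ S) →
    ∀ y ∈ Y, ∀ u, G.Adj y u → u ∈ Y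

theorem pocketFree_empty {V : Type*} {G : SimpleGraph V} : PocketFree G ∅ := by
  intro Y _ h y hy u hyu
  simpa using h y hy u hyu

/-- The edges leaving `S` from a vertex of `A`. -/
def exits {V : Type*} (G : SimpleGraph V) (A S : Finset V) : Set (V × V) :=
  {p | p.1 ∈ A ∧ p.2 ∉ S ∧ G.Adj p.1 p.2}

theorem IsCubic.finite_neighborSet {V : Type*} {G : SimpleGraph V} (hG : IsCubic G) (v : V) :
    (G.neighborSet v).Finite := by
  obtain ⟨a, b, c, -, -, -, h⟩ := hG v
  refine (Set.toFinite {a, b, c}).subset fun u hu => ?_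
  simpa using (h u).1 hu

theorem IsCubic.finite_exits {V : Type*} {G : SimpleGraph V} (hG : IsCubic G) (A S : Finset V) :
    (exits G A S).Finite := by
  refine (A.finite_toSet.prod (A.finite_toSet.biUnion
    fun v _ => hG.finite_neighborSet v)).subset fun p hp => ?_
  simp only [Set.mem_prod, Set.mem_iUnion]
  exact ⟨hp.1, p.1, hp.1, hp.2.2⟩

section

variable {V : Type*} [DecidableEq V] {G : SimpleGraph V} {S W T X : Finset V}

theorem PocketFree.union_closed (hS : PocketFree G S) {Y : Finset V}
    (hY : ∀ y ∈ Y, ∀ u, G.Adj y u → u ∈ Y) : PocketFree G (S ∪ Y) := by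
  intro Y' hd h y hy u hyu
  rw [Finset.disjoint_left] at hd
  refine hS Y' (Finset.disjoint_left.2 fun a ha ha' => hd ha (Finset.mem_union_left _ ha'))
    (fun a ha b hab => ?_) y hy u hyu
  rcases h a ha b hab with hb | hb
  · exact Or.inl hb
  · rcases Finset.mem_union.1 hb with hb | hb
    · exact Or.inr hb
    · exact absurd (Finset.mem_union_right _ (hY b hb a hab.symm)) (hd ha)

theorem Good.fill (hG : IsCubic G)
    (hK : ∀ a b c d, G.Adj a b → G.Adj a c → G.Adj a d → G.Adj b c → G.Adj b d → ¬ G.Adj c d)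
    (h : Good G S W) (hS : PocketFree G S) {Z : Finset V} (hZ : Disjoint Z S) :
    ∃ X, Extends G S W (S ∪ Z) X := by
  induction Z using Finset.strongInduction generalizing S W with
  | H Z ih =>
    by_cases hex : ∀ Y ⊆ Z, Y.Nonempty → ∃ y ∈ Y, ∃ u, u ∉ S ∧ u ∉ Y ∧ G.Adj y u
    · exact h.greedy hG Z hex
    push Not at hex
    obtain ⟨Y, hYZ, ⟨y, hy⟩, hYS⟩ := hex
    have hYd : Disjoint Y S := Finset.disjoint_of_subset_left hYZ hZ
    have hY := hS Y hYd fun a ha b hab => by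
      by_contra! hb
      exact hYS a ha b hb.2 hb.1 hab
    obtain ⟨X, e1⟩ := h.extend_closed hG hK hYd (y₀ := y) (x := y)
      fun a ha b hab => Or.inl (hY a ha b hab)
    obtain ⟨X', e2⟩ := ih (Z \ Y) (Finset.sdiff_ssubset hYZ ⟨y, hy⟩) e1.good
      (hS.union_closed hY) (by
        rw [Finset.disjoint_left] at hZ ⊢
        grind)
    rw [Finset.union_assoc, Finset.union_sdiff_of_subset hYZ] at e2
    exact ⟨X', e1.trans e2⟩

theorem PocketFree.hull (hG : IsCubic G) (hS : PocketFree G S) (Z : Finset V) :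
    ∃ Z', Z ⊆ Z' ∧ PocketFree G (S ∪ Z') := by
  suffices H : ∀ n, ∀ Z : Finset V, (exits G Z (S ∪ Z)).ncard ≤ n →
      ∃ Z', Z ⊆ Z' ∧ PocketFree G (S ∪ Z') from H _ Z le_rfl
  intro n
  induction n with
  | zero =>
    intro Z hn
    rw [Nat.le_zero, Set.ncard_eq_zero (hG.finite_exits _ _)] at hn
    refine ⟨Z, subset_rfl, fun Y hd hY => hS Y ?_ fun y hy u hyu => ?_⟩
    · exact Finset.disjoint_of_subset_right Finset.subset_union_left hd
    · rcases hY y hy u hyu with hu | hu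
      · exact Or.inl hu
      · refine Or.inr ((Finset.mem_union.1 hu).resolve_right fun huZ => ?_)
        have : (u, y) ∈ exits G Z (S ∪ Z) := ⟨huZ, Finset.disjoint_left.1 hd hy, hyu.symm⟩
        rw [hn] at this
        exact this
  | succ n ih =>
    intro Z hn
    by_cases hp : PocketFree G (S ∪ Z)
    · exact ⟨Z, subset_rfl, hp⟩
    unfold PocketFree at hp
    push Not at hp
    obtain ⟨Y, hd, hY, y, hy, u, hyu, huY⟩ := hp
    have hd' : Disjoint Y S := Finset.disjoint_of_subset_right Finset.subset_union_left hd
    have htouch : ∃ a ∈ Y, ∃ b ∈ Z, G.Adj a b := by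
      by_contra! hno
      refine huY (hS Y hd' (fun a ha b hab => ?_) y hy u hyu)
      rcases hY a ha b hab with hb | hb
      · exact Or.inl hb
      · exact Or.inr ((Finset.mem_union.1 hb).resolve_right fun hbZ => hno a ha b hbZ hab)
    obtain ⟨a, ha, b, hb, hab⟩ := htouch
    obtain ⟨Z', hZ', hp⟩ := ih (Z ∪ Y) (by
      have : (exits G (Z ∪ Y) (S ∪ (Z ∪ Y))).ncard < (exits G Z (S ∪ Z)).ncard := by
        refine Set.ncard_lt_ncard ⟨?_, fun hle => ?_⟩ (hG.finite_exits _ _)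
        · rintro ⟨p, q⟩ ⟨hp, hq, hpq⟩
          have hq' : q ∉ S ∪ Z ∧ q ∉ Y := by grind
          rcases Finset.mem_union.1 hp with hp | hp
          · exact ⟨hp, hq'.1, hpq⟩
          · exact ((hY p hp q hpq).elim hq'.2 hq'.1).elim
        · have := hle (show (b, a) ∈ exits G Z (S ∪ Z) from
            ⟨hb, Finset.disjoint_left.1 hd ha, hab.symm⟩)
          exact this.2.1 (by simp [ha])
      omega)
    exact ⟨Z', Finset.subset_union_left.trans hZ', hp⟩

/-- If `x` is an outside neighbour of `S`, then at most one pocket `Y` arises when `x` is added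
to `S`, and adding `Y` as well leaves no pocket. -/
theorem PocketFree.exists_cap (hG : IsCubic G) (hS : PocketFree G S) {k x : V} (hk : k ∈ S)
    (hx : x ∉ S) (hkx : G.Adj k x) :
    ∃ Y : Finset V, Disjoint Y (insert x S) ∧
      (∀ y ∈ Y, ∀ u, G.Adj y u → u ∈ Y ∨ u ∈ insert x S) ∧
      PocketFree G (insert x S ∪ Y) ∧ (Y = ∅ ∨ ∃ y ∈ Y, G.Adj x y) ∧
      ∃ u, G.Adj x u ∧ u ∉ insert x S ∪ Y := by
  have hexit : ∀ Y : Finset V, Disjoint Y (insert x S) →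
      (∀ y ∈ Y, ∀ u, G.Adj y u → u ∈ Y ∨ u ∈ insert x S) →
      ∃ u, G.Adj x u ∧ u ∉ insert x S ∪ Y := by
    intro Y hd hY
    by_contra! hno
    have hkY := hS (insert x Y) (by
      rw [Finset.disjoint_left] at hd ⊢
      grind) (by
      intro y hy u hyu
      rcases Finset.mem_insert.1 hy with rfl | hy
      · have := hno u hyu
        grind
      · have := hY y hy u hyu
        grind) x (Finset.mem_insert_self _ _) k hkx.symm
    rw [Finset.disjoint_left] at hd
    grind
  by_cases hp : PocketFree G (insert x S)
  · exact ⟨∅, by simp, by simp, by simpa using hp, Or.inl rfl, hexit ∅ (by simp) (by simp)⟩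
  unfold PocketFree at hp
  push Not at hp
  obtain ⟨Y, hd, hY, y, hy, u, hyu, huY⟩ := hp
  have htouch : ∃ y ∈ Y, G.Adj x y := by
    by_contra! hno
    refine huY (hS Y (Finset.disjoint_of_subset_right (Finset.subset_insert _ _) hd)
      (fun a ha b hab => ?_) y hy u hyu)
    rcases hY a ha b hab with hb | hb
    · exact Or.inl hb
    · refine Or.inr ((Finset.mem_insert.1 hb).resolve_left ?_)
      rintro rfl
      exact hno a ha hab.symm
  obtain ⟨t, ht, hxt⟩ := htouch
  obtain ⟨q, hxq, hq⟩ := hexit Y hd hY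
  refine ⟨Y, hd, hY, ?_, Or.inr ⟨t, ht, hxt⟩, q, hxq, hq⟩
  rw [Finset.disjoint_left] at hd
  have hNx : ∀ w, G.Adj x w → w = k ∨ w = t ∨ w = q := fun w hw =>
    hG.eq_of_adj hkx.symm hxt hxq (by grind) (by grind) (by grind) hw
  intro Y' hd' hY'
  rw [Finset.disjoint_left] at hd'
  by_cases hqY : q ∈ Y'
  · exfalso
    have := hS (insert x (Y ∪ Y')) (by
      rw [Finset.disjoint_left]
      grind) (by
      intro a ha b hab
      have h1 := hY a
      have h2 := hY' a
      by_cases hax : a = x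
      · subst hax
        have := hNx b hab
        grind
      · grind) x (Finset.mem_insert_self _ _) k hkx.symm
    grind
  · refine hS Y' (by
      rw [Finset.disjoint_left]
      grind) (fun a ha b hab => ?_)
    by_cases hbx : b = x
    · subst hbx
      have := hNx a hab.symm
      grind
    · have := hY' a ha b hab
      have := hY b
      have := hab.symm
      grind

theorem Good.seal (hG : IsCubic G)
    (hK : ∀ a b c d, G.Adj a b → G.Adj a c → G.Adj a d → G.Adj b c → G.Adj b d → ¬ G.Adj c d)
    (h : Good G S W) (hS : PocketFree G S) :
    ∃ T X, Extends G S W T X ∧ PocketFree G T ∧ ∀ f ∈ T, f ∉ X → ∀ u, G.Adj f u → u ∈ T := by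
  suffices H : ∀ n m, ∀ S W, (exits G (S \ W) S).ncard ≤ n → (exits G S S).ncard ≤ m →
      Good G S W → PocketFree G S → ∃ T X, Extends G S W T X ∧ PocketFree G T ∧
        ∀ f ∈ T, f ∉ X → ∀ u, G.Adj f u → u ∈ T from H _ _ S W le_rfl le_rfl h hS
  clear! S W
  intro n
  induction n with
  | zero =>
    intro m S W hn hm h hS
    rw [Nat.le_zero, Set.ncard_eq_zero (hG.finite_exits _ _)] at hn
    refine ⟨S, W, h.extends_self, hS, fun f hf hfW u hfu => ?_⟩
    by_contra hu
    have : (f, u) ∈ exits G (S \ W) S := ⟨Finset.mem_sdiff.2 ⟨hf, hfW⟩, hu, hfu⟩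
    rw [hn] at this
    exact this
  | succ n ihn =>
    intro m
    induction m with
    | zero =>
      intro S W hn hm h hS
      rw [Nat.le_zero, Set.ncard_eq_zero (hG.finite_exits _ _)] at hm
      refine ⟨S, W, h.extends_self, hS, fun f hf hfW u hfu => ?_⟩
      by_contra hu
      have : (f, u) ∈ exits G S S := ⟨hf, hu, hfu⟩
      rw [hm] at this
      exact this
    | succ m ihm =>
      intro S W hn hm h hS
      by_cases hsealed : ∀ f ∈ S, f ∉ W → ∀ u, G.Adj f u → u ∈ S
      · exact ⟨S, W, h.extends_self, hS, hsealed⟩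
      push Not at hsealed
      obtain ⟨k, hk, hkW, x, hkx, hx⟩ := hsealed
      have hkF : (k, x) ∈ exits G (S \ W) S := ⟨Finset.mem_sdiff.2 ⟨hk, hkW⟩, hx, hkx⟩
      have hkS : (k, x) ∈ exits G S S := ⟨hk, hx, hkx⟩
      obtain ⟨Y, hd, hY, hp, hYx, u, hxu, hu⟩ := hS.exists_cap hG hk hx hkx
      have hd' := hd
      rw [Finset.disjoint_left] at hd'
      by_cases hedge : ∃ s ∈ S, ∃ v ∈ insert x Y, G.Adj s v ∧ (s, v) ≠ (k, x)
      · obtain ⟨s, hs, v, hv, hsv, hne⟩ := hedge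
        have hNx : ∀ w, G.Adj x w → w ∈ insert x S ∪ Y ∨ w = u := by
          intro w hw
          by_contra! hw'
          rcases hYx with hYe | ⟨y, hy, hxy⟩
          · obtain rfl : v = x := by simpa [hYe] using hv
            have hsk : s ≠ k := fun e => hne (by rw [e])
            exact hG.not_four hkx.symm hsv.symm hxu hw (by grind) (by grind) (by grind)
              (by grind) (by grind) (by grind)
          · exact hG.not_four hkx.symm hxy hxu hw (by grind) (by grind) (by grind)
              (by grind) (by grind) (by grind)
        obtain ⟨X, e1⟩ := h.fill hG hK hS (Z := insert x Y) (by
          rw [Finset.disjoint_left]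
          grind)
        have hT : S ∪ insert x Y = insert x S ∪ Y := by grind
        have hsub : ∀ A A' : Finset V, (∀ a ∈ A', a ∈ S → a ∈ A) → A' ⊆ S ∪ insert x Y →
            exits G A' (S ∪ insert x Y) ⊆
              insert (x, u) (exits G A S \ {(k, x), (s, v)}) := by
          rintro A A' hA hA' ⟨a, b⟩ ⟨ha, hb, hab⟩
          dsimp only at ha hb hab
          have h1 := hNx b
          have h2 := hY a
          have h3 := hA' ha
          by_cases haS : a ∈ S
          · refine Or.inr ⟨⟨hA a ha haS, by grind, hab⟩, ?_⟩
            rintro (e | e)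
            · rw [Prod.mk.injEq] at e
              grind
            · rw [Set.mem_singleton_iff, Prod.mk.injEq] at e
              grind
          · left
            rw [Prod.mk.injEq]
            grind
        have hfin := fun A => hG.finite_exits A S
        have hsS : (s, v) ∈ exits G S S := ⟨hs, by grind, hsv⟩
        obtain ⟨T, X', e2, hT', hX'⟩ := ihm (S ∪ insert x Y) X (by
            refine le_trans ?_ hn
            refine (Set.ncard_le_ncard ((hsub (S \ W) _ ?_ Finset.sdiff_subset).trans
              (Set.insert_subset_insert (Set.sdiff_subset_sdiff_right
                (Set.singleton_subset_iff.2 (Set.mem_insert (k, x) _)))))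
              (((hfin _).sdiff).insert _)).trans ?_
            · intro a ha haS
              rw [Finset.mem_sdiff] at ha ⊢
              exact ⟨haS, fun haW => ha.2 ((e1.agree a haS).2 haW)⟩
            · refine (Set.ncard_insert_le _ _).trans ?_
              rw [Set.ncard_sdiff_singleton_add_one hkF (hfin _)]) (by
            have h1 := (Set.ncard_le_ncard (hsub S _ (fun _ _ h => h) subset_rfl)
              (((hfin _).sdiff).insert _)).trans (Set.ncard_insert_le _ _)
            have h2 := Set.ncard_sdiff_add_ncard_of_subset (s := {(k, x), (s, v)})
              (t := exits G S S) (by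
                rintro p (rfl | rfl)
                · exact hkS
                · exact hsS) (hfin _)
            rw [Set.ncard_pair hne.symm] at h2
            omega) e1.good (hT ▸ hp)
        exact ⟨T, X', e1.trans e2, hT', hX'⟩
      · push Not at hedge
        have e1 := h.insert_indep hx fun w hw hxw => by
          have := hedge w (h.subset hw) x (Finset.mem_insert_self _ _) hxw.symm
          rw [Prod.mk.injEq] at this
          exact hkW (this.1 ▸ hw)
        obtain ⟨y₀, hy₀⟩ : ∃ y₀, ∀ z ∈ Y, G.Adj x z → z = y₀ := by
          rcases hYx with rfl | ⟨y, hy, hxy⟩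
          · exact ⟨x, by simp⟩
          · refine ⟨y, fun z hz hxz => ?_⟩
            by_contra hzy
            exact hG.not_four hkx.symm hxy hxz hxu (by grind) (by grind) (by grind)
              (by grind) (by grind) (by grind)
        obtain ⟨X, e2⟩ := e1.good.extend_closed hG hK hd (y₀ := y₀) (x := x) (by
          intro z hz a hza
          rcases hY z hz a hza with ha | ha
          · exact Or.inl ha
          · rcases Finset.mem_insert.1 ha with rfl | ha
            · exact Or.inr ⟨hy₀ z hz hza.symm, rfl⟩
            · have := hedge a ha z (Finset.mem_insert_of_mem hz) hza.symm
              rw [Prod.mk.injEq] at this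
              have := hd' hz
              grind)
        have e3 := e1.trans e2
        have hxX : x ∈ X := (e2.agree x (Finset.mem_insert_self _ _)).2
          (Finset.mem_insert_self _ _)
        obtain ⟨T, X', e4, hT', hX'⟩ := ihn _ (insert x S ∪ Y) X (by
            refine Nat.lt_succ_iff.1 (lt_of_lt_of_le (Set.ncard_lt_ncard ⟨?_, fun hle => ?_⟩
              (hG.finite_exits _ _)) hn)
            · rintro ⟨a, b⟩ ⟨ha, hb, hab⟩
              dsimp only at ha hb hab
              have h2 := hY a
              have h3 := e3.agree a
              have haS : a ∈ S := by grind
              exact ⟨by grind, by grind, hab⟩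
            · exact (hle hkF).2.1 (by simp)) le_rfl e3.good hp
        exact ⟨T, X', e3.trans e4, hT', hX'⟩

/-- A partial solution in which the components outside the independent set are complete. -/
structure Sealed (G : SimpleGraph V) (S W : Finset V) : Prop where
  good : Good G S W
  pocketFree : PocketFree G S
  mem_of_adj : ∀ f ∈ S, f ∉ W → ∀ u, G.Adj f u → u ∈ S

theorem Sealed.exists_extends (hG : IsCubic G)
    (hK : ∀ a b c d, G.Adj a b → G.Adj a c → G.Adj a d → G.Adj b c → G.Adj b d → ¬ G.Adj c d)
    (h : Sealed G S W) (v : V) : ∃ T X, Extends G S W T X ∧ Sealed G T X ∧ v ∈ T := by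
  obtain ⟨Z, hZ, hp⟩ := h.pocketFree.hull hG {v}
  obtain ⟨R, e1⟩ := h.good.fill hG hK h.pocketFree (Z := Z \ S) Finset.sdiff_disjoint
  rw [Finset.union_sdiff_self_eq_union] at e1
  obtain ⟨T, X, e2, hT, hX⟩ := e1.good.seal hG hK hp
  exact ⟨T, X, e1.trans e2, ⟨e2.good, hT, hX⟩,
    e2.subset (Finset.mem_union_right _ (hZ (Finset.mem_singleton_self v)))⟩

theorem exists_exhaustion [Countable V] (hG : IsCubic G)
    (hK : ∀ a b c d, G.Adj a b → G.Adj a c → G.Adj a d → G.Adj b c → G.Adj b d → ¬ G.Adj c d) :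
    ∃ S W : ℕ → Finset V, (∀ n, Sealed G (S n) (W n)) ∧
      (∀ n m, n ≤ m → Extends G (S n) (W n) (S m) (W m)) ∧ ∀ v, ∃ n, v ∈ S n := by
  obtain ⟨e, he⟩ := exists_injective_nat V
  have step : ∀ (n : ℕ) (s : {p : Finset V × Finset V // Sealed G p.1 p.2}),
      ∃ t : {p : Finset V × Finset V // Sealed G p.1 p.2},
        Extends G s.1.1 s.1.2 t.1.1 t.1.2 ∧ ∀ v, e v = n → v ∈ t.1.1 := by
    rintro n ⟨⟨S, W⟩, hs⟩
    by_cases hv : ∃ v, e v = n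
    · obtain ⟨v, rfl⟩ := hv
      obtain ⟨T, X, h1, h2, h3⟩ := hs.exists_extends hG hK v
      exact ⟨⟨(T, X), h2⟩, h1, fun w hw => he hw ▸ h3⟩
    · exact ⟨⟨(S, W), hs⟩, hs.good.extends_self, fun v h => absurd ⟨v, h⟩ hv⟩
  choose next hnext hmem using step
  have h0 : Sealed G ∅ ∅ := by
    refine ⟨⟨subset_rfl, by simp, by simp, ?_⟩, pocketFree_empty, by simp⟩
    intro Y hY hne
    obtain ⟨y, hy⟩ := hne
    simpa using hY hy
  let s : ℕ → {p : Finset V × Finset V // Sealed G p.1 p.2} :=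
    fun n => Nat.rec ⟨(∅, ∅), h0⟩ (fun n t => next n t) n
  refine ⟨fun n => (s n).1.1, fun n => (s n).1.2, fun n => (s n).2, fun n m hnm => ?_,
    fun v => ⟨e v + 1, hmem (e v) (s (e v)) v rfl⟩⟩
  induction m, hnm using Nat.le_induction with
  | base => exact (s n).2.good.extends_self
  | succ m _ ih => exact ih.trans (hnext m (s m))

end

theorem IsForestOn.isAcyclic_induce {V : Type*} {G : SimpleGraph V} {F : Finset V}
    (hF : IsForestOn G F) {A : Set V} (hA : A ⊆ F) : (G.induce A).IsAcyclic := by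
  classical
  intro v c hc
  obtain ⟨y, hy, hyY⟩ := hF (c.support.toFinset.image Subtype.val) (by
    intro y hy
    obtain ⟨z, -, rfl⟩ := Finset.mem_image.1 hy
    exact hA z.2) ⟨v, Finset.mem_image_of_mem _ (by simp)⟩
  obtain ⟨z, hz, rfl⟩ := Finset.mem_image.1 hy
  rw [List.mem_toFinset] at hz
  obtain ⟨a, b, hab, h⟩ := Set.ncard_eq_two.1 (hc.ncard_neighborSet_toSubgraph_eq_two hz)
  have hmem : ∀ t ∈ ({a, b} : Set A), (t : V) ∈ c.support.toFinset.image Subtype.val ∧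
      G.Adj z t := by
    intro t ht
    rw [← h] at ht
    have ht' : c.toSubgraph.Adj z t := ht
    refine ⟨Finset.mem_image_of_mem _ ?_, ht'.adj_sub⟩
    rw [List.mem_toFinset, ← SimpleGraph.Walk.mem_verts_toSubgraph]
    exact ht'.snd_mem
  have ha := hmem a (by simp)
  have hb := hmem b (by simp)
  exact hab (Subtype.ext (hyY a ha.1 b hb.1 ha.2 hb.2))

theorem ncard_leaves_eq_two {V : Type*} {G : SimpleGraph V} {A : Set V} (hA : A.Finite)
    (htree : (G.induce A).IsTree) (hcard : A.ncard ≠ 1)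
    (hdeg : ∀ x ∈ A, (G.neighborSet x ∩ A).ncard ≤ 2) :
    {x ∈ A | (G.neighborSet x ∩ A).ncard = 1}.ncard = 2 := by
  classical
  have := hA.fintype
  have hcA : Fintype.card A = A.ncard := by
    rw [← Nat.card_eq_fintype_card, Nat.card_coe_set_eq]
  have hd : ∀ x : A, (G.induce A).degree x = (G.neighborSet x ∩ A).ncard := by
    intro x
    rw [← SimpleGraph.card_neighborSet_eq_degree, ← Nat.card_eq_fintype_card,
      Nat.card_coe_set_eq, ← Set.ncard_image_of_injective _ Subtype.val_injective]
    congr 1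
    ext u
    simp
  have hne := htree.connected.nonempty
  have : Nontrivial A := by
    rw [← Fintype.one_lt_card_iff_nontrivial]
    have := Fintype.card_pos (α := A)
    omega
  have hset : {x ∈ A | (G.neighborSet x ∩ A).ncard = 1} =
      Subtype.val '' {x : A | (G.induce A).degree x = 1} := by
    ext x
    simp [hd, and_comm]
  rw [hset, Set.ncard_image_of_injective _ Subtype.val_injective,
    Set.ncard_eq_toFinset_card', Set.toFinset_ofPred, Finset.card_filter]
  have hsum := (G.induce A).sum_degrees_eq_twice_card_edges
  have hedge := htree.card_edgeFinset
  have htwo : ∑ x : A, ((if (G.induce A).degree x = 1 then 1 else 0) + (G.induce A).degree x) =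
      ∑ _x : A, 2 := by
    refine Finset.sum_congr rfl fun x _ => ?_
    have h1 := htree.connected.preconnected.degree_pos_of_nontrivial x
    have h2 := hdeg x x.2
    rw [← hd] at h2
    split_ifs <;> omega
  rw [Finset.sum_add_distrib, Finset.sum_const, Finset.card_univ, smul_eq_mul] at htwo
  have key : ∑ x : A, (if (G.induce A).degree x = 1 then 1 else 0) = 2 := by omega
  convert key

theorem connected_induce_image_supp {V : Type*} {G : SimpleGraph V} {B : Set V}
    (c : (G.induce B).ConnectedComponent) : (G.induce (Subtype.val '' c.supp)).Connected := by
  refine c.connected_toSimpleGraph.map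
    ⟨fun x => ⟨x.1.1, Set.mem_image_of_mem _ x.2⟩, fun {a b} hab => ?_⟩ ?_
  · exact hab
  · rintro ⟨_, x, hx, rfl⟩
    exact ⟨⟨x, hx⟩, rfl⟩

end CubicGraph

open CubicGraph

theorem stmt17 {V : Type} [Countable V] (G : SimpleGraph V)
    (hreg : ∀ v : V, (G.neighborSet v).ncard = 3)
    (hclique : G.CliqueFree 4) :
    ∃ W : Set V,
      (∀ x ∈ W, ∀ y ∈ W, ¬ G.Adj x y) ∧
      (∀ c : (G.induce (Wᶜ : Set V)).ConnectedComponent,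
        (Subtype.val '' c.supp).Finite ∧
        ((Subtype.val '' c.supp).ncard = 1 ∨ IsPathGraphOn G (Subtype.val '' c.supp))) ∧
      (∀ x ∈ (Wᶜ : Set V), (G.neighborSet x ∩ (Wᶜ : Set V)).ncard ≤ 2) ∧
      (∀ D : Set V, D ⊆ (Wᶜ : Set V) → ¬ IsCircleIn G D) := by
  classical
  have hG : IsCubic G := by
    intro v
    obtain ⟨a, b, c, hab, hac, hbc, h⟩ := Set.ncard_eq_three.1 (hreg v)
    refine ⟨a, b, c, hab, hac, hbc, fun u => ?_⟩
    rw [← SimpleGraph.mem_neighborSet, h]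
    simp
  have hK : ∀ a b c d, G.Adj a b → G.Adj a c → G.Adj a d → G.Adj b c → G.Adj b d →
      ¬ G.Adj c d := by
    intro a b c d hab hac had hbc hbd hcd
    refine hclique (insert a {b, c, d}) (SimpleGraph.IsNClique.insert
      (SimpleGraph.is3Clique_iff.2 ⟨b, c, d, hbc, hbd, hcd, rfl⟩) ?_)
    simp [hab, hac, had]
  obtain ⟨S, W, hsealed, hext, hcover⟩ := exists_exhaustion hG hK
  have hmono : ∀ {n m v}, n ≤ m → v ∈ S n → v ∈ S m := fun h hv => (hext _ _ h).subset hv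
  have hW : ∀ {n v}, v ∈ S n → ((∃ m, v ∈ W m) ↔ v ∈ W n) := by
    refine fun {n v} hv => ⟨fun ⟨m, hm⟩ => ?_, fun h => ⟨n, h⟩⟩
    have h1 := (hext m (max m n) (le_max_left _ _)).agree v ((hsealed m).good.subset hm)
    exact ((hext n (max m n) (le_max_right _ _)).agree v hv).1 (h1.2 hm)
  have hdom : ∀ x ∈ ({v | ∃ n, v ∈ W n}ᶜ : Set V),
      (G.neighborSet x ∩ {v | ∃ n, v ∈ W n}ᶜ).ncard ≤ 2 := by
    intro x hx
    obtain ⟨n, hn⟩ := hcover x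
    obtain ⟨w, hw, hxw⟩ := (hsealed n).good.dom x hn fun h => hx ⟨n, h⟩
    have hfin := hG.finite_neighborSet x
    have h1 : G.neighborSet x ∩ {v | ∃ n, v ∈ W n}ᶜ ⊆ G.neighborSet x \ {w} := by
      rintro u ⟨hu, huW⟩
      refine ⟨hu, ?_⟩
      rintro rfl
      exact huW ⟨n, hw⟩
    have h2 := Set.ncard_le_ncard h1 hfin.sdiff
    have h3 := Set.ncard_sdiff_singleton_add_one (show w ∈ G.neighborSet x from hxw) hfin
    rw [hreg] at h3
    omega
  refine ⟨{v | ∃ n, v ∈ W n}, ?_, ?_, hdom, ?_⟩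
  · rintro x ⟨n, hn⟩ y ⟨m, hm⟩
    have hx := hmono (le_max_left n m) ((hsealed n).good.subset hn)
    have hy := hmono (le_max_right n m) ((hsealed m).good.subset hm)
    exact (hsealed (max n m)).good.indep x ((hW hx).1 ⟨n, hn⟩) y ((hW hy).1 ⟨m, hm⟩)
  · intro c
    obtain ⟨v, hv⟩ := c.nonempty_supp
    obtain ⟨n, hn⟩ := hcover v
    have hwalk : ∀ {a b} (_ : (G.induce ({v | ∃ n, v ∈ W n}ᶜ : Set V)).Walk a b),
        (a : V) ∈ S n → (b : V) ∈ S n := by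
      intro a b p
      induction p with
      | nil => exact id
      | @cons a _ _ hab _ ih =>
        exact fun ha => ih ((hsealed n).mem_of_adj _ ha (fun h => a.2 ⟨n, h⟩) _ hab)
    have hsub : Subtype.val '' c.supp ⊆ ((S n \ W n : Finset V) : Set V) := by
      rintro _ ⟨b, hb, rfl⟩
      obtain ⟨p⟩ := SimpleGraph.ConnectedComponent.exact (hv.trans hb.symm)
      exact Finset.mem_coe.2 (Finset.mem_sdiff.2 ⟨hwalk p hn, fun h => b.2 ⟨n, h⟩⟩)
    have hfin := (Finset.finite_toSet _).subset hsub
    have hconn := connected_induce_image_supp c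
    refine ⟨hfin, or_iff_not_imp_left.2 fun hcard => ?_⟩
    have hdeg : ∀ x ∈ Subtype.val '' c.supp,
        (G.neighborSet x ∩ Subtype.val '' c.supp).ncard ≤ 2 := by
      rintro _ ⟨x, hx, rfl⟩
      refine le_trans (Set.ncard_le_ncard ?_ ((hG.finite_neighborSet _).inter_of_left _))
        (hdom x x.2)
      refine Set.inter_subset_inter_right _ ?_
      rintro _ ⟨y, -, rfl⟩
      exact y.2
    exact ⟨hfin, hconn, hdeg, ncard_leaves_eq_two hfin
      ⟨hconn, (hsealed n).good.forest.isAcyclic_induce hsub⟩ hcard hdeg⟩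
  · rintro D hD ⟨hfin, hconn, hdeg⟩
    choose g hg using hcover
    obtain ⟨⟨v, hv⟩⟩ := hconn.nonempty
    have hDS : ∀ x ∈ D, x ∈ S (hfin.toFinset.sup g) := fun x hx =>
      hmono (Finset.le_sup (f := g) (hfin.mem_toFinset.2 hx)) (hg x)
    obtain ⟨y, hy, h⟩ := (hsealed (hfin.toFinset.sup g)).good.forest hfin.toFinset
      (fun x hx => by
        rw [Set.Finite.mem_toFinset] at hx
        exact Finset.mem_sdiff.2 ⟨hDS x hx, fun hxW => hD hx ⟨_, hxW⟩⟩)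
      ⟨v, hfin.mem_toFinset.2 hv⟩
    simp only [Set.Finite.mem_toFinset] at hy h
    obtain ⟨a, b, hab, he⟩ := Set.ncard_eq_two.1 (hdeg y hy)
    have ha : a ∈ G.neighborSet y ∩ D := he ▸ Set.mem_insert a {b}
    have hb : b ∈ G.neighborSet y ∩ D := he ▸ Set.mem_insert_of_mem a rfl
    exact hab (h a ha.2 b hb.2 ha.1 hb.1)
end

section
/- Let d ≥ 4 and let G = (V,E) be a countable d-regular simple graph which contains no clique on d+1 vertices. Then there exists an independent set W ⊆ V such that the subgraph H of G induced by V ∖ W has maximum degree at most d−1 and contains no clique on d vertices. -/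
open Classical in
/-- A family of pairwise disjoint finite sets with at least two elements each has an independent
transversal with respect to any symmetric relation of maximum degree one that is never satisfied
inside a member of the family. -/
theorem exists_independent_transversal_of_matching {ι V : Type*} (C : ι → Finset V)
    (R : V → V → Prop) (hcard : ∀ i, 2 ≤ (C i).card)
    (hdisj : ∀ i j v, v ∈ C i → v ∈ C j → i = j)
    (hsymm : ∀ v w, R v w → R w v) (huniq : ∀ u v w, R u v → R u w → v = w)
    (hin : ∀ i v w, v ∈ C i → w ∈ C i → ¬ R v w) :
    ∃ f : ι → V, (∀ i, f i ∈ C i) ∧ ∀ i j, i ≠ j → ¬ R (f i) (f j) := by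
  let e : V → Set V := fun v => {w | w = v ∨ R v w}
  have he : ∀ v w, R v w → e v = e w := by
    intro v w h
    ext x
    simp only [e, Set.mem_ofPred_eq]
    constructor
    · rintro (rfl | hx)
      · exact Or.inr (hsymm _ _ h)
      · exact Or.inl (huniq _ _ _ hx h)
    · rintro (rfl | hx)
      · exact Or.inr h
      · exact Or.inl (huniq _ _ _ hx (hsymm _ _ h))
  have hev : ∀ v w, e v = e w → w = v ∨ R v w := by
    intro v w h
    have hw : w ∈ e w := Or.inl rfl
    rwa [← h] at hw
  have hall : ∀ s : Finset ι, s.card ≤ (s.biUnion fun i => (C i).image e).card := by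
    intro s
    have key := Finset.card_mul_le_card_mul (s := s)
      (t := s.biUnion fun i => (C i).image e) (fun i b => b ∈ (C i).image e) (m := 2) (n := 2) ?_ ?_
    · omega
    · intro i hi
      have hsub : (C i).image e ⊆ Finset.bipartiteAbove (fun i b => b ∈ (C i).image e)
          (s.biUnion fun i => (C i).image e) i := by
        intro b hb
        rw [Finset.mem_bipartiteAbove]
        exact ⟨Finset.mem_biUnion.2 ⟨i, hi, hb⟩, hb⟩
      refine le_trans ?_ (Finset.card_le_card hsub)
      rw [Finset.card_image_of_injOn]
      · exact hcard i
      · intro v hv w hw h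
        rcases hev v w h with h | h
        · exact h.symm
        · exact absurd h (hin i v w hv hw)
    · intro b _
      by_contra! hlt
      obtain ⟨i, j, k, hi, hj, hk, hij, hik, hjk⟩ := Finset.two_lt_card_iff.1 hlt
      simp only [Finset.mem_bipartiteBelow, Finset.mem_image] at hi hj hk
      obtain ⟨-, x, hx, hxb⟩ := hi
      obtain ⟨-, y, hy, hyb⟩ := hj
      obtain ⟨-, z, hz, hzb⟩ := hk
      rcases hev x y (hxb.trans hyb.symm) with rfl | hxy
      · exact hij (hdisj _ _ _ hx hy)
      rcases hev x z (hxb.trans hzb.symm) with rfl | hxz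
      · exact hik (hdisj _ _ _ hx hz)
      obtain rfl := huniq _ _ _ hxy hxz
      exact hjk (hdisj _ _ _ hy hz)
  obtain ⟨f, hinj, hf⟩ := (Finset.all_card_le_biUnion_card_iff_exists_injective _).1 hall
  choose g hg hgf using fun i => Finset.mem_image.1 (hf i)
  refine ⟨g, hg, fun i j hij h => hij (hinj ?_)⟩
  rw [← hgf i, ← hgf j, he _ _ h]

namespace SimpleGraph

variable {V : Type*} {G : SimpleGraph V} {d : ℕ}

theorem exists_closedNeighborFinset (hd : d ≠ 0) {v : V} (hv : (G.neighborSet v).ncard = d) :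
    ∃ S : Finset V, S.card = d + 1 ∧ ∀ w, w ∈ S ↔ w = v ∨ G.Adj v w := by
  classical
  have hfin : (G.neighborSet v).Finite := Set.finite_of_ncard_ne_zero (by omega)
  refine ⟨insert v hfin.toFinset, ?_, fun w => by simp⟩
  rw [Finset.card_insert_of_notMem (by simp), ← Set.ncard_eq_toFinset_card _ hfin, hv]

theorem IsNClique.subset_of_mem_closedNeighborFinset {K S : Finset V} {n : ℕ} {v : V}
    (hK : G.IsNClique n K) (hv : v ∈ K) (hS : ∀ w, w ∈ S ↔ w = v ∨ G.Adj v w) : K ⊆ S := by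
  intro w hw
  rw [hS]
  by_cases h : w = v
  · exact Or.inl h
  · exact Or.inr (hK.isClique hv hw (Ne.symm h))

open Classical in
theorem card_inter_of_isNClique (hd : d ≠ 0) (hreg : ∀ v, (G.neighborSet v).ncard = d)
    {K L : Finset V} (hK : G.IsNClique d K) (hL : G.IsNClique d L) {v : V} (hvK : v ∈ K)
    (hvL : v ∈ L) : d - 1 ≤ (K ∩ L).card := by
  obtain ⟨S, hS, hmem⟩ := exists_closedNeighborFinset hd (hreg v)
  have h := Finset.card_le_card (Finset.union_subset
    (hK.subset_of_mem_closedNeighborFinset hvK hmem)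
    (hL.subset_of_mem_closedNeighborFinset hvL hmem))
  have := Finset.card_union_add_card_inter K L
  have := hK.card_eq
  have := hL.card_eq
  omega

open Classical in
theorem union_eq_of_isNClique {K L S : Finset V} (hK : G.IsNClique d K)
    (hL : G.IsNClique d L) (hKL : K ≠ L) (hKS : K ⊆ S) (hLS : L ⊆ S) (hS : S.card = d + 1) :
    K ∪ L = S := by
  refine Finset.eq_of_subset_of_card_le (Finset.union_subset hKS hLS) ?_
  by_contra! hlt
  have hKe : K = K ∪ L := Finset.eq_of_subset_of_card_le Finset.subset_union_left
    (by rw [hK.card_eq]; omega)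
  have hLe : L = K ∪ L := Finset.eq_of_subset_of_card_le Finset.subset_union_right
    (by rw [hL.card_eq]; omega)
  exact hKL (hKe.trans hLe.symm)

/-- Three distinct `d`-cliques with a common vertex would force a `(d + 1)`-clique. -/
theorem eq_or_eq_or_eq_of_isNClique (hd : d ≠ 0) (hreg : ∀ v, (G.neighborSet v).ncard = d)
    (hfree : G.CliqueFree (d + 1)) {K L M : Finset V} (hK : G.IsNClique d K)
    (hL : G.IsNClique d L) (hM : G.IsNClique d M) {v : V} (hvK : v ∈ K) (hvL : v ∈ L)
    (hvM : v ∈ M) : K = L ∨ K = M ∨ L = M := by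
  classical
  by_contra! hne
  obtain ⟨hKL, hKM, hLM⟩ := hne
  obtain ⟨S, hS, hmem⟩ := exists_closedNeighborFinset hd (hreg v)
  have hKS := hK.subset_of_mem_closedNeighborFinset hvK hmem
  have hLS := hL.subset_of_mem_closedNeighborFinset hvL hmem
  have hMS := hM.subset_of_mem_closedNeighborFinset hvM hmem
  have h1 := union_eq_of_isNClique hK hL hKL hKS hLS hS
  have h2 := union_eq_of_isNClique hK hM hKM hKS hMS hS
  have h3 := union_eq_of_isNClique hL hM hLM hLS hMS hS
  have hor : ∀ x ∈ S, (x ∈ K ∨ x ∈ L) ∧ (x ∈ K ∨ x ∈ M) ∧ (x ∈ L ∨ x ∈ M) := fun x hx =>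
    ⟨Finset.mem_union.1 (h1 ▸ hx), Finset.mem_union.1 (h2 ▸ hx), Finset.mem_union.1 (h3 ▸ hx)⟩
  refine hfree S ⟨fun x hx y hy hxy => ?_, hS⟩
  have hx' := hor x hx
  have hy' := hor y hy
  have hcommon : (x ∈ K ∧ y ∈ K) ∨ (x ∈ L ∧ y ∈ L) ∨ (x ∈ M ∧ y ∈ M) := by tauto
  rcases hcommon with ⟨h, h'⟩ | ⟨h, h'⟩ | ⟨h, h'⟩
  · exact hK.isClique h h' hxy
  · exact hL.isClique h h' hxy
  · exact hM.isClique h h' hxy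

theorem exists_mem_of_isNClique_of_meet (hd : 3 ≤ d) (hreg : ∀ v, (G.neighborSet v).ncard = d)
    {K L M : Finset V} (hK : G.IsNClique d K) (hL : G.IsNClique d L) (hM : G.IsNClique d M)
    (hKL : ∃ v ∈ K, v ∈ L) (hKM : ∃ v ∈ K, v ∈ M) : ∃ v, v ∈ K ∧ v ∈ L ∧ v ∈ M := by
  classical
  obtain ⟨v, hvK, hvL⟩ := hKL
  obtain ⟨w, hwK, hwM⟩ := hKM
  have h1 := card_inter_of_isNClique (by omega) hreg hK hL hvK hvL
  have h2 := card_inter_of_isNClique (by omega) hreg hK hM hwK hwM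
  have h3 := Finset.card_union_add_card_inter (K ∩ L) (K ∩ M)
  have h4 : ((K ∩ L) ∪ (K ∩ M)).card ≤ d := hK.card_eq ▸
    Finset.card_le_card (Finset.union_subset Finset.inter_subset_left Finset.inter_subset_left)
  obtain ⟨x, hx⟩ : ((K ∩ L) ∩ (K ∩ M)).Nonempty := Finset.card_pos.1 (by omega)
  simp only [Finset.mem_inter] at hx
  exact ⟨x, hx.1.1, hx.1.2, hx.2.2⟩

open Classical in
/-- The vertices of `K` that lie in every `d`-clique meeting `K`. -/
noncomputable def cliqueCore (G : SimpleGraph V) (d : ℕ) (K : Finset V) : Finset V :=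
  K.filter fun v => ∀ L, G.IsNClique d L → (∃ w ∈ K, w ∈ L) → v ∈ L

theorem cliqueCore_subset (K : Finset V) : G.cliqueCore d K ⊆ K := by
  classical
  exact Finset.filter_subset _ _

theorem mem_cliqueCore {K : Finset V} {v : V} : v ∈ G.cliqueCore d K ↔
    v ∈ K ∧ ∀ L, G.IsNClique d L → (∃ w ∈ K, w ∈ L) → v ∈ L := by
  classical
  exact Finset.mem_filter

theorem cliqueCore_eq_of_meet (hd : 3 ≤ d) (hreg : ∀ v, (G.neighborSet v).ncard = d)
    {K L : Finset V} (hK : G.IsNClique d K) (hL : G.IsNClique d L) (hKL : ∃ v ∈ K, v ∈ L) :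
    G.cliqueCore d K = G.cliqueCore d L := by
  have aux : ∀ {K L : Finset V}, G.IsNClique d K → G.IsNClique d L → (∃ v ∈ K, v ∈ L) →
      G.cliqueCore d K ⊆ G.cliqueCore d L := by
    intro K L hK hL hKL v hv
    rw [mem_cliqueCore] at hv ⊢
    refine ⟨hv.2 L hL hKL, fun M hM hLM => hv.2 M hM ?_⟩
    obtain ⟨w, hw⟩ := hKL
    obtain ⟨x, -, hxK, hxM⟩ := exists_mem_of_isNClique_of_meet hd hreg hL hK hM ⟨w, hw.symm⟩ hLM
    exact ⟨x, hxK, hxM⟩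
  obtain ⟨w, hw⟩ := hKL
  exact (aux hK hL ⟨w, hw⟩).antisymm (aux hL hK ⟨w, hw.symm⟩)

theorem two_le_card_cliqueCore (hd : 3 ≤ d) (hreg : ∀ v, (G.neighborSet v).ncard = d)
    (hfree : G.CliqueFree (d + 1)) {K : Finset V} (hK : G.IsNClique d K) :
    2 ≤ (G.cliqueCore d K).card := by
  classical
  by_cases h : ∃ L, G.IsNClique d L ∧ (∃ v ∈ K, v ∈ L) ∧ K ≠ L
  · obtain ⟨L, hL, ⟨v, hvK, hvL⟩, hne⟩ := h
    have hcard := card_inter_of_isNClique (by omega) hreg hK hL hvK hvL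
    have hsub : K ∩ L ⊆ G.cliqueCore d K := by
      intro x hx
      rw [Finset.mem_inter] at hx
      refine mem_cliqueCore.2 ⟨hx.1, fun M hM hKM => ?_⟩
      obtain ⟨w, hwK, hwL, hwM⟩ :=
        exists_mem_of_isNClique_of_meet hd hreg hK hL hM ⟨v, hvK, hvL⟩ hKM
      rcases eq_or_eq_or_eq_of_isNClique (by omega) hreg hfree hK hL hM hwK hwL hwM with
        h | rfl | rfl
      · exact absurd h hne
      · exact hx.1
      · exact hx.2
    have := Finset.card_le_card hsub
    omega
  · push Not at h
    have hsub : K ⊆ G.cliqueCore d K := fun x hx =>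
      mem_cliqueCore.2 ⟨hx, fun L hL hKL => h L hL hKL ▸ hx⟩
    have := Finset.card_le_card hsub
    have := hK.card_eq
    omega

theorem eq_of_adj_of_notMem_isNClique (hd : d ≠ 0) (hreg : ∀ v, (G.neighborSet v).ncard = d)
    {K : Finset V} (hK : G.IsNClique d K) {u v w : V} (hu : u ∈ K) (hv : v ∉ K) (hw : w ∉ K)
    (huv : G.Adj u v) (huw : G.Adj u w) : v = w := by
  classical
  obtain ⟨S, hS, hmem⟩ := exists_closedNeighborFinset hd (hreg u)
  have hKS := hK.subset_of_mem_closedNeighborFinset hu hmem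
  have hcard : (S \ K).card ≤ 1 := by
    rw [Finset.card_sdiff_of_subset hKS, hS, hK.card_eq]
    omega
  exact Finset.card_le_one.1 hcard v
    (Finset.mem_sdiff.2 ⟨(hmem v).2 (Or.inr huv), hv⟩) w
    (Finset.mem_sdiff.2 ⟨(hmem w).2 (Or.inr huw), hw⟩)

theorem exists_isIndepSet_meeting_isNClique (hd : 3 ≤ d)
    (hreg : ∀ v, (G.neighborSet v).ncard = d) (hfree : G.CliqueFree (d + 1)) :
    ∃ W : Set V, G.IsIndepSet W ∧ ∀ K, G.IsNClique d K → ∃ v ∈ K, v ∈ W := by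
  let Q : V → Prop := fun v => ∃ K, G.IsNClique d K ∧ v ∈ G.cliqueCore d K
  let ι := {C : Finset V // ∃ K, G.IsNClique d K ∧ G.cliqueCore d K = C}
  obtain ⟨f, hf, hR⟩ := exists_independent_transversal_of_matching
    (fun i : ι => i.1)
    (fun v w => G.Adj v w ∧ Q v ∧ Q w ∧ ∀ K, G.IsNClique d K → v ∈ K → w ∉ K)
    (by
      rintro ⟨_, K, hK, rfl⟩
      exact two_le_card_cliqueCore hd hreg hfree hK)
    (by
      rintro ⟨_, K, hK, rfl⟩ ⟨_, L, hL, rfl⟩ v hv hw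
      exact Subtype.ext (cliqueCore_eq_of_meet hd hreg hK hL
        ⟨v, cliqueCore_subset K hv, cliqueCore_subset L hw⟩))
    (fun v w h => ⟨h.1.symm, h.2.2.1, h.2.1, fun K hK hw hv => h.2.2.2 K hK hv hw⟩)
    (by
      rintro u v w ⟨huv, ⟨K, hK, huK⟩, -, hv⟩ ⟨huw, -, -, hw⟩
      have hu := cliqueCore_subset K huK
      exact eq_of_adj_of_notMem_isNClique (by omega) hreg hK hu (hv K hK hu) (hw K hK hu) huv huw)
    (by
      rintro ⟨_, K, hK, rfl⟩ v w hv hw h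
      exact h.2.2.2 K hK (cliqueCore_subset K hv) (cliqueCore_subset K hw))
  refine ⟨Set.range f, ?_, fun K hK => ?_⟩
  · rintro _ ⟨i, rfl⟩ _ ⟨j, rfl⟩ hne hadj
    have hij : i ≠ j := fun h => hne (congrArg f h)
    have hi := hf i
    have hj := hf j
    obtain ⟨K, hK, hKi⟩ := i.2
    obtain ⟨L, hL, hLj⟩ := j.2
    rw [← hKi] at hi
    rw [← hLj] at hj
    refine hR i j hij ⟨hadj, ⟨K, hK, hi⟩, ⟨L, hL, hj⟩, fun M hM hMi hMj => hij (Subtype.ext ?_)⟩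
    rw [← hKi, ← hLj, cliqueCore_eq_of_meet hd hreg hK hM ⟨_, cliqueCore_subset K hi, hMi⟩,
      cliqueCore_eq_of_meet hd hreg hL hM ⟨_, cliqueCore_subset L hj, hMj⟩]
  · exact ⟨_, cliqueCore_subset K (hf ⟨_, K, hK, rfl⟩), Set.mem_range_self _⟩

theorem IsIndepSet.exists_maximal_superset {W : Set V} (hW : G.IsIndepSet W) :
    ∃ M, W ⊆ M ∧ Maximal G.IsIndepSet M := by
  refine zorn_subset_nonempty {s | G.IsIndepSet s} (fun c hc hchain _ =>
    ⟨⋃₀ c, ?_, fun s hs => Set.subset_sUnion_of_mem hs⟩) W hW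
  exact (Set.pairwise_sUnion hchain.directedOn).2 hc

theorem exists_adj_of_maximal_isIndepSet {W : Set V} (hW : Maximal G.IsIndepSet W) {x : V}
    (hx : x ∉ W) : ∃ w ∈ W, G.Adj x w := by
  by_contra! h
  refine hx (hW.2 (y := insert x W) ?_ (Set.subset_insert x W) (Set.mem_insert x W))
  exact hW.1.insert fun w hw _ => ⟨h w hw, fun hadj => h w hw hadj.symm⟩

end SimpleGraph

theorem stmt18 {V : Type} [Countable V] (G : SimpleGraph V) (d : ℕ) (hd : 4 ≤ d)
    (hreg : ∀ v : V, (G.neighborSet v).ncard = d)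
    (hclique : G.CliqueFree (d + 1)) :
    ∃ W : Set V,
      (∀ x ∈ W, ∀ y ∈ W, ¬ G.Adj x y) ∧
      (∀ x ∈ (Wᶜ : Set V), (G.neighborSet x ∩ (Wᶜ : Set V)).ncard ≤ d - 1) ∧
      ∀ s : Finset V, ↑s ⊆ (Wᶜ : Set V) → ¬ G.IsNClique d s := by
  obtain ⟨W₀, hindep, hmeet⟩ :=
    SimpleGraph.exists_isIndepSet_meeting_isNClique (by omega) hreg hclique
  obtain ⟨W, hsub, hmax⟩ := hindep.exists_maximal_superset
  refine ⟨W, fun x hx y hy hadj => hmax.1 hx hy hadj.ne hadj, fun x hx => ?_, fun s hs hcl => ?_⟩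
  · obtain ⟨w, hw, hadj⟩ := SimpleGraph.exists_adj_of_maximal_isIndepSet hmax hx
    have hfin : (G.neighborSet x).Finite :=
      Set.finite_of_ncard_ne_zero (by rw [hreg]; omega)
    have hlt : (G.neighborSet x ∩ Wᶜ).ncard < (G.neighborSet x).ncard :=
      Set.ncard_lt_ncard (Set.ssubset_iff_subset_ne.2 ⟨Set.inter_subset_left, fun h =>
        (h.symm ▸ hadj : w ∈ G.neighborSet x ∩ Wᶜ).2 hw⟩) hfin
    rw [hreg] at hlt
    omega
  · obtain ⟨v, hv, hvW⟩ := hmeet s hcl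
    exact hs hv (hsub hvW)
end

section
/- Let C be the simple graph with the six vertices a, p, q, r, b, x and with exactly the edges {a,p}, {a,q}, {p,q}, {p,r}, {q,r}, {r,b}, {b,x}. Then every proper 3-coloring c of C satisfies c(a) ≠ c(b). Consequently, since a, b, and x all have degree at most 2 in C, a proper 3-coloring of the subgraph of C induced by {a,b,x} which assigns the same color to a and b cannot be extended to a proper 3-coloring of C. -/
/-- The edges of the graph `C`: with vertices `a = 0`, `p = 1`, `q = 2`, `r = 3`, `b = 4`,
`x = 5`, the edges are `{a,p}, {a,q}, {p,q}, {p,r}, {q,r}, {r,b}, {b,x}`. -/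
def edges19 : List (Fin 6 × Fin 6) := [(0, 1), (0, 2), (1, 2), (1, 3), (2, 3), (3, 4), (4, 5)]

/-- The graph `C` on the six vertices `a = 0`, `p = 1`, `q = 2`, `r = 3`, `b = 4`, `x = 5`
with exactly the edges `{a,p}, {a,q}, {p,q}, {p,r}, {q,r}, {r,b}, {b,x}`. -/
def C19 : SimpleGraph (Fin 6) := SimpleGraph.fromRel (fun u v => (u, v) ∈ edges19)

instance : DecidableRel C19.Adj := fun u v =>
  decidable_of_iff (u ≠ v ∧ ((u, v) ∈ edges19 ∨ (v, u) ∈ edges19))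
    (SimpleGraph.fromRel_adj (fun u v => (u, v) ∈ edges19) u v).symm

theorem C19_coloring_ne (c : Fin 6 → Fin 3) (hc : ∀ u v, C19.Adj u v → c u ≠ c v) :
    c 0 ≠ c 4 := by
  have h01 := hc 0 1 (by decide)
  have h02 := hc 0 2 (by decide)
  have h12 := hc 1 2 (by decide)
  have h13 := hc 1 3 (by decide)
  have h23 := hc 2 3 (by decide)
  have h34 := hc 3 4 (by decide)
  omega

theorem C19_ncard_neighborSet_le {v : Fin 6} (h : C19.degree v ≤ 2) :
    (C19.neighborSet v).ncard ≤ 2 := by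
  rwa [← SimpleGraph.coe_neighborFinset, Set.ncard_coe_finset]

theorem stmt19 :
    (∀ c : Fin 6 → Fin 3, (∀ u v, C19.Adj u v → c u ≠ c v) → c 0 ≠ c 4) ∧
    ((C19.neighborSet 0).ncard ≤ 2 ∧ (C19.neighborSet 4).ncard ≤ 2 ∧
      (C19.neighborSet 5).ncard ≤ 2) ∧
    (∀ c₀ : Fin 6 → Fin 3,
      (∀ u v, u ∈ ({0, 4, 5} : Set (Fin 6)) → v ∈ ({0, 4, 5} : Set (Fin 6)) →
        C19.Adj u v → c₀ u ≠ c₀ v) →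
      c₀ 0 = c₀ 4 →
      ¬ ∃ c : Fin 6 → Fin 3, (∀ u v, C19.Adj u v → c u ≠ c v) ∧
        ∀ v ∈ ({0, 4, 5} : Set (Fin 6)), c v = c₀ v) := by
  refine ⟨C19_coloring_ne, ⟨C19_ncard_neighborSet_le (by decide),
    C19_ncard_neighborSet_le (by decide), C19_ncard_neighborSet_le (by decide)⟩, ?_⟩
  rintro c₀ - h ⟨c, hc, hext⟩
  exact C19_coloring_ne c hc (by rw [hext 0 (by simp), hext 4 (by simp), h])
end
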